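/- Let m ≥ 4, n ≥ 2m, and let π = (d_1, …, d_n) be a non-increasing graphic sequence with d_{2m+1−i} ≥ i+1 for every 1 ≤ i ≤ m−1. Then π has a realization G containing cycles C_3, …, C_{2m} all lying on the 2m vertices of G whose degrees are d_1, …, d_{2m}. -/

import Mathlib

/-- `G` contains a cycle of length `r`. -/
def hasCycleOfLength {V : Type*} (G : SimpleGraph V) (r : ℕ) : Prop :=
  ∃ (v : V) (c : G.Walk v v), c.IsCycle ∧ c.length = r

/-- `G` is a realization of the sequence `d`, i.e. `d` is its degree sequence. -/
def IsDegreeSeq {n : ℕ} (G : SimpleGraph (Fin n)) (d : Fin n → ℕ) : Prop :=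
  ∀ i, (G.neighborSet i).ncard = d i

/-- The sequence `d` is graphic: it is the degree sequence of a simple graph. -/
def Graphic {n : ℕ} (d : Fin n → ℕ) : Prop :=
  ∃ G : SimpleGraph (Fin n), IsDegreeSeq G d

/-- `d` is potentially ₃Cℓ-graphic: some realization contains cycles of every
length `r` with `3 ≤ r ≤ ℓ`. -/
def Pot3C {n : ℕ} (ℓ : ℕ) (d : Fin n → ℕ) : Prop :=
  ∃ G : SimpleGraph (Fin n), IsDegreeSeq G d ∧ ∀ r, 3 ≤ r → r ≤ ℓ → hasCycleOfLength G r

/-- `d` is potentially Cℓ-graphic: some realization contains a cycle of length `ℓ`. -/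
def PotC {n : ℕ} (ℓ : ℕ) (d : Fin n → ℕ) : Prop :=
  ∃ G : SimpleGraph (Fin n), IsDegreeSeq G d ∧ hasCycleOfLength G ℓ

/-- `d` has a realization `G` containing cycles `C₃, …, C_ℓ` on those vertices with
degrees `d 0, …, d (ℓ-1)`: the induced subgraph on some vertex set `S`, whose multiset
of degrees is that of the first `ℓ` terms of `d`, contains cycles of all lengths
from `3` to `ℓ`. -/
def RealizationWithCyclesOn {n : ℕ} (ℓ : ℕ) (d : Fin n → ℕ) : Prop :=
  ∃ (G : SimpleGraph (Fin n)) (S : Finset (Fin n)),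
    IsDegreeSeq G d ∧ S.card = ℓ ∧
    S.val.map d = (Finset.univ.filter (fun i : Fin n => (i : ℕ) < ℓ)).val.map d ∧
    ∀ r, 3 ≤ r → r ≤ ℓ → hasCycleOfLength (G.induce (S : Set (Fin n))) r

set_option linter.unusedSectionVars false
set_option linter.unusedSimpArgs false
set_option linter.unusedVariables false
noncomputable section
namespace L28
open Finset
open scoped Classical

variable {V : Type} [Fintype V]

/-- neighbours as a finset -/
def nb (G : SimpleGraph V) (v : V) : Finset V := univ.filter (fun u => G.Adj v u)

@[simp] lemma mem_nb (G : SimpleGraph V) (v u : V) : u ∈ nb G v ↔ G.Adj v u := by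
  simp [nb]

/-- realization -/
def Rlz (d : V → ℕ) (G : SimpleGraph V) : Prop := ∀ v, (nb G v).card = d v

/-- the switch: remove `ab`, `ce`, add `ac`, `be` -/
def sw (G : SimpleGraph V) (a b c e : V) : SimpleGraph V where
  Adj u v := u ≠ v ∧ ((G.Adj u v ∧ ¬(u = a ∧ v = b) ∧ ¬(u = b ∧ v = a) ∧
    ¬(u = c ∧ v = e) ∧ ¬(u = e ∧ v = c)) ∨ (u = a ∧ v = c) ∨ (u = c ∧ v = a) ∨
    (u = b ∧ v = e) ∨ (u = e ∧ v = b))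
  symm := ⟨by
    intro u v h
    have := G.adj_comm u v
    grind⟩
  loopless := ⟨by intro u h; exact h.1 rfl⟩

lemma sw_adj (G : SimpleGraph V) (a b c e u v : V) : (sw G a b c e).Adj u v ↔
  u ≠ v ∧ ((G.Adj u v ∧ ¬(u = a ∧ v = b) ∧ ¬(u = b ∧ v = a) ∧
    ¬(u = c ∧ v = e) ∧ ¬(u = e ∧ v = c)) ∨ (u = a ∧ v = c) ∨ (u = c ∧ v = a) ∨
    (u = b ∧ v = e) ∨ (u = e ∧ v = b)) := Iff.rfl

lemma card_swap {s t : Finset V} {x y : V} (hx : x ∈ s) (hy : y ∉ s)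
    (h : ∀ u, u ∈ t ↔ (u = y ∨ (u ∈ s ∧ u ≠ x))) : t.card = s.card := by
  have : t = insert y (s.erase x) := by ext u; simp [h]; tauto
  rw [this, card_insert_of_notMem (by simp [hy]), card_erase_of_mem hx]
  have := card_pos.2 ⟨x, hx⟩
  omega

lemma sw_rlz {d : V → ℕ} {G : SimpleGraph V} (h : Rlz d G) {a b c e : V}
    (hab : G.Adj a b) (hce : G.Adj c e) (hac : ¬ G.Adj a c) (hbe : ¬ G.Adj b e)
    (n1 : a ≠ c) (n2 : b ≠ e) (n3 : a ≠ e) (n4 : b ≠ c) : Rlz d (sw G a b c e) := by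
  intro v
  rw [← h v]
  have nab := hab.ne
  have nce := hce.ne
  have hba := hab.symm
  have hec := hce.symm
  have hca : ¬ G.Adj c a := fun h => hac h.symm
  have heb : ¬ G.Adj e b := fun h => hbe h.symm
  by_cases va : v = a
  · subst va
    refine card_swap (x := b) (y := c) (by simpa) (by simpa) ?_
    intro u; have := G.ne_of_adj (a := v) (b := u)
    simp only [mem_nb, sw_adj]; grind
  by_cases vb : v = b
  · subst vb
    refine card_swap (x := a) (y := e) (by simpa) (by simpa) ?_
    intro u; have := G.ne_of_adj (a := v) (b := u)
    simp only [mem_nb, sw_adj]; grind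
  by_cases vc : v = c
  · subst vc
    refine card_swap (x := e) (y := a) (by simpa) (by simpa) ?_
    intro u; have := G.ne_of_adj (a := v) (b := u)
    simp only [mem_nb, sw_adj]; grind
  by_cases ve : v = e
  · subst ve
    refine card_swap (x := c) (y := b) (by simpa) (by simpa) ?_
    intro u; have := G.ne_of_adj (a := v) (b := u)
    simp only [mem_nb, sw_adj]; grind
  congr 1
  ext u; have := G.ne_of_adj (a := v) (b := u)
  simp only [mem_nb, sw_adj]; grind

/-- cycles from functions -/
lemma path_of_fun {W : Type} (G : SimpleGraph W) (f : ℕ → W) (r : ℕ)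
    (hadj : ∀ i, i < r → G.Adj (f i) (f (i + 1)))
    (hinj : ∀ i ≤ r, ∀ j ≤ r, f i = f j → i = j) :
    ∃ p : G.Walk (f 0) (f r), p.IsPath ∧ p.length = r ∧ ∀ x ∈ p.support, ∃ i ≤ r, x = f i := by
  induction r with
  | zero => exact ⟨SimpleGraph.Walk.nil, by simp, by simp, by simp⟩
  | succ r ih =>
    obtain ⟨p, hp, hl, hs⟩ := ih (fun i hi => hadj i (by omega))
      (fun i hi j hj => hinj i (by omega) j (by omega))
    refine ⟨p.concat (hadj r (by omega)), ?_, by simp [hl], ?_⟩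
    · apply hp.concat
      intro hx
      obtain ⟨i, hi, he⟩ := hs _ hx
      have := hinj _ le_rfl _ (by omega) he
      omega
    · intro x hx
      rw [SimpleGraph.Walk.support_concat] at hx
      simp at hx
      rcases hx with hx | hx
      · obtain ⟨i, hi, he⟩ := hs _ hx
        exact ⟨i, by omega, he⟩
      · exact ⟨r + 1, le_rfl, hx⟩

lemma cycle_of_fun {W : Type} (G : SimpleGraph W) (f : ℕ → W) (r : ℕ) (hr : 3 ≤ r)
    (hadj : ∀ i, i + 1 < r → G.Adj (f i) (f (i + 1)))
    (hclose : G.Adj (f (r - 1)) (f 0))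
    (hinj : ∀ i < r, ∀ j < r, f i = f j → i = j) : hasCycleOfLength G r := by
  obtain ⟨p, hp, hl, hs⟩ := path_of_fun G f (r - 1) (fun i hi => hadj i (by omega))
    (fun i hi j hj => hinj i (by omega) j (by omega))
  refine ⟨f (r - 1), SimpleGraph.Walk.cons hclose p, ?_, by simp [hl]; omega⟩
  rw [SimpleGraph.Walk.cons_isCycle_iff]
  refine ⟨hp, fun he => ?_⟩
  have := hp.length_eq_one_of_mem_edges (u := f 0) (v := f (r-1)) (by rwa [Sym2.eq_swap])
  omega

lemma CF (G : SimpleGraph V) (S : Finset V) (f : ℕ → V) (r : ℕ) (hr : 3 ≤ r)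
    (hS : ∀ i < r, f i ∈ S)
    (hadj : ∀ i, i + 1 < r → G.Adj (f i) (f (i + 1)))
    (hclose : G.Adj (f (r - 1)) (f 0))
    (hinj : ∀ i < r, ∀ j < r, f i = f j → i = j) :
    hasCycleOfLength (G.induce (S : Set V)) r := by
  have h0 := hS 0 (by omega)
  refine cycle_of_fun _ (fun i => if h : i < r then ⟨f i, hS i h⟩ else ⟨f 0, h0⟩) r hr ?_ ?_ ?_
  · intro i hi
    have := hadj i hi
    simp [show i < r by omega, hi, this]
  · have : r - 1 < r := by omega
    simp [this, show 0 < r by omega, hclose]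
  · intro i hi j hj h
    simp [hi, hj] at h
    exact hinj i hi j hj h

/-- a cycle of length `r` inside `S`, as a function -/
def Cyc (G : SimpleGraph V) (S : Finset V) (r : ℕ) : Prop :=
  ∃ f : ℕ → V, (∀ i < r, f i ∈ S) ∧ (∀ i, i + 1 < r → G.Adj (f i) (f (i + 1))) ∧
    G.Adj (f (r - 1)) (f 0) ∧ (∀ i < r, ∀ j < r, f i = f j → i = j)

/-- a Hamiltonian cyclic order of `S` -/
structure HamC (G : SimpleGraph V) (S : Finset V) (N : ℕ) (p : ℕ → V) : Prop where
  mem : ∀ i < N, p i ∈ S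
  inj : ∀ i < N, ∀ j < N, p i = p j → i = j
  adj : ∀ i, i + 1 < N → G.Adj (p i) (p (i + 1))
  close : G.Adj (p (N - 1)) (p 0)

lemma ord_surj {S : Finset V} {N : ℕ} {p : ℕ → V} (hc : S.card = N) (hm : ∀ i < N, p i ∈ S)
    (hi : ∀ i < N, ∀ j < N, p i = p j → i = j) : ∀ s ∈ S, ∃ i < N, p i = s := by
  have h1 : (range N).image p = S := by
    apply eq_of_subset_of_card_le
    · intro x hx; simp at hx; obtain ⟨i, h, rfl⟩ := hx; exact hm i h
    · rw [card_image_of_injOn]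
      · simp [hc]
      · intro i h j h'; simp at h h'; exact hi i h j h'
  intro s hs; rw [← h1] at hs; simpa using hs

lemma mod_cases (M i s : ℕ) (hi : i < M) (hs : s < M) :
    (i + s) % M = if i + s < M then i + s else i + s - M := by
  split_ifs with h
  · exact Nat.mod_eq_of_lt h
  · rw [Nat.mod_eq_sub_mod (by omega), Nat.mod_eq_of_lt (by omega)]

lemma hub {G : SimpleGraph V} {S' : Finset V} {m : ℕ} {p : ℕ → V} (hm : 2 ≤ m)
    (hc : S'.card = 2 * m - 1)
    (hp : HamC G S' (2 * m - 1) p) {g : V} (hg : g ∉ S')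
    (hd : m ≤ (S'.filter (fun v => G.Adj g v)).card) :
    ∀ r, 3 ≤ r → r ≤ 2 * m → Cyc G (insert g S') r := by
  intro r h3 hr
  obtain ⟨M, hM⟩ : ∃ M, M = 2 * m - 1 := ⟨_, rfl⟩
  rw [← hM] at hp hc
  set s := r - 2 with hs
  set A := (range M).filter (fun i => G.Adj g (p i)) with hA
  have hAc : m ≤ A.card := by
    refine hd.trans ?_
    rw [← card_image_of_injOn (f := p) (s := A)]
    · apply card_le_card
      intro v hv
      simp at hv
      obtain ⟨i, hi, rfl⟩ := ord_surj hc hp.mem hp.inj v hv.1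
      simp [hA]; exact ⟨i, ⟨hi, hv.2⟩, rfl⟩
    · intro i h j h'; simp [hA] at h h'; exact hp.inj i h.1 j h'.1
  have hA2 : ∀ i ∈ A, i < M ∧ G.Adj g (p i) := by intro i hi; simpa [hA] using hi
  obtain ⟨i, hi, hi'⟩ : ∃ i ∈ A, (i + s) % M ∈ A := by
    by_contra hcon
    push Not at hcon
    have hinj : Set.InjOn (fun i => (i + s) % M) (A : Set ℕ) := by
      intro i h j h' he
      have h := (hA2 i h).1
      have h' := (hA2 j h').1
      simp only [mod_cases M i s h (by omega), mod_cases M j s h' (by omega)] at he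
      split_ifs at he <;> omega
    have hdis : Disjoint A (A.image (fun i => (i + s) % M)) := by
      rw [disjoint_left]
      intro a ha hb
      simp at hb
      obtain ⟨i, hi, rfl⟩ := hb
      exact hcon i hi ha
    have h1 := card_union_of_disjoint hdis
    rw [card_image_of_injOn hinj] at h1
    have h2 : (A ∪ (A.image (fun i => (i + s) % M))).card ≤ (range M).card := by
      apply card_le_card
      intro a ha
      simp at ha
      rcases ha with ha | ⟨i, hi, rfl⟩
      · simpa using (hA2 a ha).1
      · simpa using Nat.mod_lt _ (by omega)
    simp at h2
    omega
  obtain ⟨hi1, hi2⟩ := hA2 i hi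
  obtain ⟨hj1, hj2⟩ := hA2 _ hi'
  refine ⟨(fun t => if t = 0 then g else p ((i + (t - 1)) % M)), ?_, ?_, ?_, ?_⟩ <;> beta_reduce
  · intro t ht
    by_cases h : t = 0
    · simp [h]
    · simp [h]; right; exact hp.mem _ (Nat.mod_lt _ (by omega))
  · intro t ht
    by_cases h : t = 0
    · subst h; simpa [Nat.mod_eq_of_lt hi1] using hi2
    · simp only [h, if_false, Nat.add_eq_zero_iff, one_ne_zero, and_false]
      rw [mod_cases M i _ hi1 (by omega), mod_cases M i _ hi1 (by omega)]
      by_cases h1 : i + (t - 1) + 1 < M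
      · rw [if_pos (by omega), if_pos (by omega)]
        convert hp.adj _ h1 using 2; omega
      · by_cases h2 : i + (t - 1) + 1 = M
        · rw [if_pos (by omega), if_neg (by omega)]
          convert hp.close using 2 <;> omega
        · rw [if_neg (by omega), if_neg (by omega)]
          convert hp.adj (i + (t - 1) - M) (by omega) using 2; omega
  · rw [if_neg (by omega), if_pos rfl]
    apply SimpleGraph.Adj.symm; convert hj2 using 4; omega
  · intro t ht u hu he
    try dsimp only at he
    have key : ∀ t, t < r → t ≠ 0 → p ((i + (t-1)) % M) ≠ g := by
      intro t ht h0 he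
      exact hg (he ▸ hp.mem _ (Nat.mod_lt _ (by omega)))
    split_ifs at he with h1 h2 h2
    · omega
    · exact absurd he.symm (key u hu h2)
    · exact absurd he (key t ht h1)
    · have := hp.inj _ (Nat.mod_lt _ (by omega)) _ (Nat.mod_lt _ (by omega)) he
      rw [mod_cases M i _ hi1 (by omega), mod_cases M i _ hi1 (by omega)] at this
      split_ifs at this <;> omega

/-- Bondy -/
lemma bondy {G : SimpleGraph V} {S : Finset V} {N : ℕ} {p : ℕ → V} (hN : 4 ≤ N)
    (hc : S.card = N) (hp : HamC G S N p)
    (h0 : nb G (p 0) ⊆ S) (h1 : nb G (p (N - 1)) ⊆ S)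
    (hd : N + 1 ≤ (nb G (p 0)).card + (nb G (p (N - 1))).card) :
    ∀ r, 3 ≤ r → r ≤ N → Cyc G S r := by
  intro r h3 hr
  set A := (Icc 1 (N - 2)).filter (fun i => G.Adj (p 0) (p i)) with hA
  set B := (Icc 1 (N - 2)).filter (fun i => G.Adj (p (N - 1)) (p i)) with hB
  have hAc : (nb G (p 0)).card ≤ A.card + 1 := by
    have : nb G (p 0) ⊆ insert (p (N - 1)) (A.image p) := by
      intro v hv
      obtain ⟨i, hi, rfl⟩ := ord_surj hc hp.mem hp.inj v (h0 hv)
      rw [mem_nb] at hv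
      by_cases h : i = N - 1
      · simp [h]
      · have : i ≠ 0 := by rintro rfl; exact G.irrefl hv
        simp [hA]; right; exact ⟨i, ⟨by omega, hv⟩, rfl⟩
    refine (card_le_card this).trans ((card_insert_le _ _).trans ?_)
    have := card_image_le (s := A) (f := p)
    omega
  have hBc : (nb G (p (N - 1))).card ≤ B.card + 1 := by
    have : nb G (p (N - 1)) ⊆ insert (p 0) (B.image p) := by
      intro v hv
      obtain ⟨i, hi, rfl⟩ := ord_surj hc hp.mem hp.inj v (h1 hv)
      rw [mem_nb] at hv
      by_cases h : i = 0
      · simp [h]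
      · have : i ≠ N - 1 := by rintro rfl; exact G.irrefl hv
        simp [hB]; right; exact ⟨i, ⟨by omega, hv⟩, rfl⟩
    refine (card_le_card this).trans ((card_insert_le _ _).trans ?_)
    have := card_image_le (s := B) (f := p)
    omega
  have hA2 : ∀ i ∈ A, (1 ≤ i ∧ i ≤ N - 2) ∧ G.Adj (p 0) (p i) := by
    intro i hi; simpa [hA] using hi
  have hB2 : ∀ i ∈ B, (1 ≤ i ∧ i ≤ N - 2) ∧ G.Adj (p (N - 1)) (p i) := by
    intro i hi; simpa [hB] using hi
  let φ : ℕ → ℕ := fun i => if i + r - 3 ≤ N - 2 then i + r - 3 else i + r - 1 - N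
  obtain ⟨i, hi, hi'⟩ : ∃ i ∈ A, φ i ∈ B := by
    by_contra hcon
    push Not at hcon
    have hinj : Set.InjOn φ (A : Set ℕ) := by
      intro i h j h' he
      have h := (hA2 i h).1
      have h' := (hA2 j h').1
      simp only [φ] at he
      split_ifs at he <;> omega
    have hdis : Disjoint B (A.image φ) := by
      rw [disjoint_left]
      intro a ha hb
      rw [mem_image] at hb
      obtain ⟨i, hi, rfl⟩ := hb
      exact hcon i hi ha
    have h1 := card_union_of_disjoint hdis
    rw [card_image_of_injOn hinj] at h1
    have h2 : (B ∪ (A.image φ)).card ≤ (Icc 1 (N - 2)).card := by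
      apply card_le_card
      intro a ha
      simp only [mem_union, mem_image, mem_Icc] at ha ⊢
      rcases ha with ha | ⟨i, hi, rfl⟩
      · exact (hB2 a ha).1
      · have := (hA2 i hi).1
        simp only [φ]; split_ifs <;> omega
    simp at h2
    omega
  obtain ⟨hi1, hi2⟩ := hA2 i hi
  obtain ⟨hj1, hj2⟩ := hB2 _ hi'
  by_cases hcase : i + r - 3 ≤ N - 2
  · simp only [φ, if_pos hcase] at hj1 hj2
    have fe : ∀ t, t < r → (fun t => if t = 0 then 0 else if t = r - 1 then N - 1 else i + (t - 1)) t < N := by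
      intro t ht; dsimp only; split_ifs <;> omega
    refine ⟨(fun t => p (if t = 0 then 0 else if t = r - 1 then N - 1 else i + (t - 1))), ?_, ?_, ?_, ?_⟩ <;> beta_reduce
    · intro t ht; exact hp.mem _ (fe t ht)
    · intro t ht
      by_cases h : t = 0
      · subst h; simpa [show ¬ (1 = r - 1) by omega] using hi2
      · by_cases h' : t + 1 = r - 1
        · simp only [h, h', if_false, if_true, Nat.add_eq_zero_iff, one_ne_zero, and_false, show ¬ (r - 1 = 0) by omega, show ¬ (t = r - 1) by omega]
          apply SimpleGraph.Adj.symm; convert hj2 using 2; omega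
        · simp only [h, h', if_false, Nat.add_eq_zero_iff, one_ne_zero, and_false, show ¬ (t = r - 1) by omega]
          convert hp.adj (i + (t - 1)) (by omega) using 2; omega
    · simp only [show ¬ (r - 1 = 0) by omega, if_false, if_true]; exact hp.close
    · intro t ht u hu he
      have := hp.inj _ (fe t ht) _ (fe u hu) he
      dsimp only at this
      split_ifs at this <;> omega
  · simp only [φ, if_neg hcase] at hj1 hj2
    obtain ⟨j, hj⟩ : ∃ j, j = i + r - 1 - N := ⟨_, rfl⟩
    rw [← hj] at hj1 hj2
    have fe : ∀ t, t < r → (fun t => if t ≤ j then t else N - 1 - (t - (j + 1))) t < N := by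
      intro t ht; dsimp only; split_ifs <;> omega
    refine ⟨(fun t => p (if t ≤ j then t else N - 1 - (t - (j + 1)))), ?_, ?_, ?_, ?_⟩ <;> beta_reduce
    · intro t ht; exact hp.mem _ (fe t ht)
    · intro t ht
      by_cases h : t + 1 ≤ j
      · rw [if_pos (by omega), if_pos h]; exact hp.adj _ (by omega)
      · by_cases h' : t = j
        · subst h'
          rw [if_pos le_rfl, if_neg h]; apply SimpleGraph.Adj.symm; convert hj2 using 2; omega
        · rw [if_neg (by omega), if_neg (by omega)]
          apply SimpleGraph.Adj.symm
          convert hp.adj (N - 1 - (t + 1 - (j + 1))) (by omega) using 2; omega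
    · rw [if_neg (by omega), if_pos (by omega)]
      apply SimpleGraph.Adj.symm; convert hi2 using 2; omega
    · intro t ht u hu he
      have := hp.inj _ (fe t ht) _ (fe u hu) he
      dsimp only at this
      split_ifs at this <;> omega

lemma HH {d : V → ℕ} {G₀ : SimpleGraph V} (h₀ : Rlz d G₀) (z : V) :
    ∃ G, Rlz d G ∧ ∀ u v, G.Adj z u → ¬ G.Adj z v → v ≠ z → d v ≤ d u := by
  obtain ⟨G, hG, hmax⟩ := Set.exists_max_image {G : SimpleGraph V | Rlz d G}
    (fun G => ∑ u ∈ nb G z, d u) (Set.toFinite _) ⟨G₀, h₀⟩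
  refine ⟨G, hG, fun u v hu hv hvz => ?_⟩
  by_contra hlt
  push Not at hlt
  have huv : u ≠ v := by rintro rfl; exact hv hu
  obtain ⟨w, hw1, hw2⟩ : ∃ w ∈ (nb G v).erase u, w ∉ nb G u := by
    by_contra hcon
    push Not at hcon
    have hsub : (nb G v).erase u ⊆ (nb G u).erase z := by
      intro w hw
      rw [mem_erase]
      refine ⟨?_, hcon w hw⟩
      rintro rfl
      simp at hw
      exact hv hw.2.symm
    have h1 := card_le_card hsub
    rw [card_erase_of_mem (s := nb G u) (by simpa using hu.symm), hG u] at h1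
    have h2 := pred_card_le_card_erase (s := nb G v) (a := u)
    rw [hG v] at h2
    have h3 : 0 < d u := by rw [← hG u]; exact card_pos.2 ⟨z, by simpa using hu.symm⟩
    omega
  simp at hw1 hw2
  have hwz : z ≠ w := by rintro rfl; exact hv hw1.2.symm
  have hR : Rlz d (sw G z u v w) := sw_rlz hG hu hw1.2 hv hw2 hvz.symm (Ne.symm hw1.1) hwz huv
  have h5 := hmax _ hR
  have h6 : nb (sw G z u v w) z = insert v ((nb G z).erase u) := by
    ext x
    have := G.ne_of_adj (a := z) (b := x)
    have := hu.ne
    simp only [mem_nb, sw_adj, mem_insert, mem_erase]; grind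
  simp only [h6] at h5
  rw [sum_insert (by simp [hv])] at h5
  have h7 := add_sum_erase (nb G z) d (a := u) (by simpa using hu)
  omega

/-- delete all edges at `g` -/
def delG (G : SimpleGraph V) (g : V) : SimpleGraph V where
  Adj u v := G.Adj u v ∧ u ≠ g ∧ v ≠ g
  symm := ⟨fun u v h => ⟨h.1.symm, h.2.2, h.2.1⟩⟩
  loopless := ⟨fun u h => G.irrefl h.1⟩

/-- add a star -/
def addS (G : SimpleGraph V) (g : V) (Q : Finset V) : SimpleGraph V where
  Adj u v := u ≠ v ∧ (G.Adj u v ∨ (u = g ∧ v ∈ Q) ∨ (v = g ∧ u ∈ Q))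
  symm := ⟨by intro u v h; have := G.adj_comm u v; grind⟩
  loopless := ⟨fun u h => h.1 rfl⟩

/-- residual sequence -/
def dl (d : V → ℕ) (g : V) (Q : Finset V) (v : V) : ℕ :=
  if v = g then 0 else if v ∈ Q then d v - 1 else d v

lemma del_rlz {d : V → ℕ} {G : SimpleGraph V} (h : Rlz d G) (g : V) :
    Rlz (dl d g (nb G g)) (delG G g) := by
  intro v
  unfold dl
  split_ifs with h1 h2
  · subst h1
    rw [card_eq_zero, eq_empty_iff_forall_notMem]
    intro x; simp [delG]
  · rw [mem_nb] at h2
    have : nb (delG G g) v = (nb G v).erase g := by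
      ext x; simp [delG]; tauto
    rw [this, card_erase_of_mem (by simpa using h2.symm), h v]
  · rw [mem_nb] at h2
    rw [← h v]
    congr 1
    ext x; simp [delG]
    intro hx
    refine ⟨h1, ?_⟩
    rintro rfl; exact h2 hx.symm

lemma add_rlz {d : V → ℕ} {G : SimpleGraph V} {g : V} {Q : Finset V} (h : Rlz (dl d g Q) G)
    (hg : g ∉ Q) (hpos : ∀ v ∈ Q, 0 < d v) (hd : d g = Q.card) : Rlz d (addS G g Q) := by
  have hg0 : ∀ x, ¬ G.Adj g x := by
    intro x hx
    have := h g
    simp [dl] at this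
    rw [eq_empty_iff_forall_notMem] at this
    exact this x (by simpa using hx)
  have hg1 : ∀ x, ¬ G.Adj x g := fun x hx => hg0 x hx.symm
  intro v
  by_cases h1 : v = g
  · subst h1
    rw [hd]
    congr 1
    ext x
    have := hg0 x
    simp [addS]
    grind
  · have hv := h v
    simp [dl, h1] at hv
    by_cases h2 : v ∈ Q
    · rw [if_pos h2] at hv
      have : nb (addS G g Q) v = insert g (nb G v) := by
        ext x
        have := G.ne_of_adj (a := v) (b := x)
        simp [addS]; grind
      rw [this, card_insert_of_notMem (by simpa using hg1 v), hv]
      have := hpos v h2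
      omega
    · rw [if_neg h2] at hv
      rw [← hv]
      congr 1
      ext x
      have := G.ne_of_adj (a := v) (b := x)
      simp [addS]; grind

lemma addS_le {G : SimpleGraph V} (g : V) (Q : Finset V) {u v : V} (h : G.Adj u v) :
    (addS G g Q).Adj u v := ⟨h.ne, Or.inl h⟩

lemma Cyc.mono {G G' : SimpleGraph V} {S : Finset V} {r : ℕ} (h : Cyc G S r)
    (hle : ∀ u v, G.Adj u v → G'.Adj u v) : Cyc G' S r := by
  obtain ⟨f, h1, h2, h3, h4⟩ := h
  exact ⟨f, h1, fun i hi => hle _ _ (h2 i hi), hle _ _ h3, h4⟩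

/-- top sets -/
def Top (d : V → ℕ) (S : Finset V) : Prop := ∀ s ∈ S, ∀ o, o ∉ S → d o ≤ d s

lemma exists_top (d : V → ℕ) (U : Finset V) (k : ℕ) (hk : k ≤ U.card) :
    ∃ S ⊆ U, S.card = k ∧ ∀ s ∈ S, ∀ o ∈ U, o ∉ S → d o ≤ d s := by
  obtain ⟨S, hS, hmax⟩ := exists_max_image (powersetCard k U) (fun S => ∑ u ∈ S, d u)
    (powersetCard_nonempty.2 hk)
  rw [mem_powersetCard] at hS
  refine ⟨S, hS.1, hS.2, fun s hs o hoU ho => ?_⟩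
  by_contra hlt
  push Not at hlt
  have h1 := hmax (insert o (S.erase s)) (by
    rw [mem_powersetCard]
    constructor
    · intro x hx; simp at hx
      rcases hx with rfl | hx
      · exact hoU
      · exact hS.1 hx.2
    · rw [card_insert_of_notMem (by simp [ho]), card_erase_of_mem hs]
      have := card_pos.2 ⟨s, hs⟩
      omega)
  rw [sum_insert (by simp [ho])] at h1
  have h7 := add_sum_erase S d hs
  omega

lemma swapSame {d : V → ℕ} {G : SimpleGraph V} (h : Rlz d G) {s t : V} (hst : d s = d t) :
    Rlz d (G.comap (Equiv.swap s t)) := by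
  intro v
  have h1 : d (Equiv.swap s t v) = d v := by
    rw [Equiv.swap_apply_def]; split_ifs <;> simp_all
  rw [← h1, ← h]
  rw [← card_image_of_injective _ (Equiv.swap s t).injective]
  congr 1
  ext x
  simp
  constructor
  · rintro ⟨y, hy, rfl⟩; exact hy
  · intro hx; exact ⟨Equiv.swap s t x, by simpa using hx, by simp⟩

lemma transfer (d : V → ℕ) (R : Finset ℕ) (T : Finset V) (hT : Top d T) :
    ∀ (k : ℕ) (S : Finset V) (G : SimpleGraph V), (S \ T).card = k → S.card = T.card → Top d S →
      Rlz d G → (∀ r ∈ R, Cyc G S r) → ∃ G', Rlz d G' ∧ ∀ r ∈ R, Cyc G' T r := by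
  intro k
  induction k with
  | zero =>
    intro S G hk hc hS hG hR
    rw [card_eq_zero, sdiff_eq_empty_iff_subset] at hk
    have := eq_of_subset_of_card_le hk hc.ge
    subst this
    exact ⟨G, hG, hR⟩
  | succ k ih =>
    intro S G hk hc hS hG hR
    have hk' : (T \ S).card = k + 1 := by
      have h1 := card_sdiff_add_card_inter S T
      have h2 := card_sdiff_add_card_inter T S
      rw [inter_comm T S] at h2
      omega
    obtain ⟨s, hs⟩ := card_pos.1 (show 0 < (S \ T).card by omega)
    obtain ⟨t, ht⟩ := card_pos.1 (show 0 < (T \ S).card by omega)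
    rw [mem_sdiff] at hs ht
    have hst : d s = d t := le_antisymm (hT t ht.1 s hs.2) (hS s hs.1 t ht.2)
    have hne : s ≠ t := by rintro rfl; exact hs.2 ht.1
    refine ih (insert t (S.erase s)) (G.comap (Equiv.swap s t)) ?_ ?_ ?_ (swapSame hG hst) ?_
    · have : insert t (S.erase s) \ T = (S \ T).erase s := by
        ext x; simp only [mem_sdiff, mem_insert, mem_erase]; grind
      rw [this, card_erase_of_mem (by simp [hs]), hk]; rfl
    · rw [card_insert_of_notMem (by simp [ht.2]), card_erase_of_mem hs.1]
      have := card_pos.2 ⟨s, hs.1⟩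
      omega
    · intro a ha o ho
      simp only [mem_insert, mem_erase] at ha ho
      have : d a = d s ∨ a ∈ S := by grind
      have h2 : d o = d s ∨ o ∉ S := by grind
      rcases this with h | h <;> rcases h2 with h' | h'
      · omega
      · rw [h]; exact hS s hs.1 o h'
      · rw [h', hst]; exact hS a h t ht.2
      · exact hS a h o h'
    · intro r hr
      obtain ⟨f, h1, h2, h3, h4⟩ := hR r hr
      refine ⟨fun i => Equiv.swap s t (f i), ?_, ?_, ?_, ?_⟩
      · intro i hi
        have := h1 i hi
        simp only [mem_insert, mem_erase]
        rw [Equiv.swap_apply_def]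
        split_ifs <;> grind
      · intro i hi; simpa using h2 i hi
      · simpa using h3
      · intro i hi j hj he
        exact h4 i hi j hj (by simpa using he)

section

/-- the gaps of an order -/
def gapS (G : SimpleGraph V) (N : ℕ) (p : ℕ → V) : Finset ℕ :=
  (range (N - 1)).filter (fun i => ¬ G.Adj (p i) (p (i + 1)))

lemma mem_gapS {G : SimpleGraph V} {N : ℕ} {p : ℕ → V} {i : ℕ} :
    i ∈ gapS G N p ↔ i < N - 1 ∧ ¬ G.Adj (p i) (p (i + 1)) := by simp [gapS]

/-- a state with the minimum number of gaps -/
structure St (d : V → ℕ) (S : Finset V) (N : ℕ) (G : SimpleGraph V) (p : ℕ → V) : Prop where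
  rlz : Rlz d G
  mem : ∀ i < N, p i ∈ S
  inj : ∀ i < N, ∀ j < N, p i = p j → i = j
  min : ∀ G' p', Rlz d G' → (∀ i < N, p' i ∈ S) → (∀ i < N, ∀ j < N, p' i = p' j → i = j) →
    (gapS G N p).card ≤ (gapS G' N p').card

def NoHam (d : V → ℕ) (S : Finset V) (N : ℕ) : Prop :=
  ∀ G p, Rlz d G → ¬ HamC G S N p

variable {d : V → ℕ} {S : Finset V} {N : ℕ} {G G' : SimpleGraph V} {p p' : ℕ → V}

lemma St.of_le (h : St d S N G p) (hr : Rlz d G') (hm : ∀ i < N, p' i ∈ S)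
    (hi : ∀ i < N, ∀ j < N, p' i = p' j → i = j)
    (hle : (gapS G' N p').card ≤ (gapS G N p).card) : St d S N G' p' :=
  ⟨hr, hm, hi, fun G'' p'' h1 h2 h3 => hle.trans (h.min G'' p'' h1 h2 h3)⟩

lemma St.of_eq (h : St d S N G p) (he : ∀ t < N, p' t = p t) : St d S N G p' := by
  refine h.of_le h.rlz ?_ ?_ ?_
  · intro i hi; rw [he i hi]; exact h.mem i hi
  · intro i hi j hj h'; rw [he i hi, he j hj] at h'; exact h.inj i hi j hj h'
  · apply card_le_card
    intro t ht
    rw [mem_gapS] at *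
    rw [he t (by omega), he (t+1) (by omega)] at ht
    exact ht

/-- reversal -/
def rv (N : ℕ) (p : ℕ → V) (t : ℕ) : V := p (N - 1 - t)

lemma St.rev (h : St d S N G p) : St d S N G (rv N p) := by
  refine h.of_le h.rlz ?_ ?_ ?_
  · intro i hi; exact h.mem _ (by omega)
  · intro i hi j hj he
    have := h.inj _ (by omega) _ (by omega) he
    omega
  · apply card_le_card_of_injOn (fun t => N - 2 - t)
    · intro t ht
      simp only [mem_coe, mem_gapS] at *
      refine ⟨by omega, fun hc => ht.2 ?_⟩
      simp only [rv]
      apply SimpleGraph.Adj.symm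
      convert hc using 2 <;> omega
    · intro t ht u hu he
      simp only [mem_coe, mem_gapS] at *
      omega

lemma St.close (hN : 3 ≤ N) (hnh : NoHam d S N) (h : St d S N G p) :
    ¬ G.Adj (p (N - 1)) (p 0) := by
  intro hc
  by_cases h0 : ∃ s, s ∈ gapS G N p
  · obtain ⟨s, hs⟩ := h0
    have hs' := mem_gapS.1 hs
    have hle := h.min G (fun t => p (if t + s + 1 < N then t + s + 1 else t + s + 1 - N)) h.rlz
      (fun i hi => h.mem _ (by split_ifs <;> omega))
      (fun i hi j hj he => by
        have := h.inj _ (by split_ifs <;> omega) _ (by split_ifs <;> omega) he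
        split_ifs at this <;> omega)
    have h2 : (gapS G N (fun t => p (if t + s + 1 < N then t + s + 1 else t + s + 1 - N))).card ≤
        ((gapS G N p).erase s).card := by
      apply card_le_card_of_injOn (fun t => if t + s + 1 < N then t + s + 1 else t + s + 1 - N)
      · intro t ht
        simp only [mem_coe, mem_gapS, mem_erase] at *
        obtain ⟨ht1, ht2⟩ := ht
        have hne : t + s + 1 ≠ N - 1 := by
          intro he
          apply ht2
          rw [if_pos (by omega), if_neg (by omega)]
          convert hc using 2 <;> omega
        refine ⟨by split_ifs <;> omega, by split_ifs <;> omega, fun hcc => ht2 ?_⟩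
        convert hcc using 2
        split_ifs <;> omega
      · intro t ht u hu he
        simp only [mem_coe, mem_gapS] at *
        split_ifs at he <;> omega
    rw [card_erase_of_mem hs] at h2
    have := card_pos.2 ⟨s, hs⟩
    omega
  · push Not at h0
    refine hnh G p h.rlz ⟨h.mem, h.inj, fun i hi => ?_, hc⟩
    have := h0 i
    rw [mem_gapS] at this
    push Not at this
    exact this (by omega)

/-- reversal of an initial part -/
def pr (i : ℕ) (p : ℕ → V) (t : ℕ) : V := if t ≤ i then p (i - t) else p t

lemma pr_ord (h : St d S N G p) {i : ℕ} (hi : i + 1 < N) : (∀ t < N, pr i p t ∈ S) ∧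
    (∀ t < N, ∀ u < N, pr i p t = pr i p u → t = u) := by
  constructor
  · intro t ht; unfold pr; split_ifs <;> exact h.mem _ (by omega)
  · intro t ht u hu he
    unfold pr at he
    split_ifs at he <;> have := h.inj _ (by omega) _ (by omega) he <;> omega

lemma pr_inj {i : ℕ} : Set.InjOn (fun t => if t < i then i - 1 - t else t) (gapS G N p : Set ℕ) := by
  intro t ht u hu he
  dsimp only at he
  split_ifs at he <;> omega

lemma pr_maps {i : ℕ} (hi : i + 1 < N)
    (h1 : G.Adj (p i) (p (i + 1)) → G'.Adj (p 0) (p (i + 1)))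
    (h2 : ∀ t, t + 1 < N → t ≠ i → G.Adj (p t) (p (t + 1)) → G'.Adj (p t) (p (t + 1))) :
    ∀ t ∈ gapS G' N (pr i p), (if t < i then i - 1 - t else t) ∈ gapS G N p := by
  intro t ht
  rw [mem_gapS] at *
  obtain ⟨ht1, ht2⟩ := ht
  by_cases hti : t < i
  · rw [if_pos hti]
    refine ⟨by omega, fun hc => ht2 ?_⟩
    have := h2 _ (by omega) (by omega) hc
    simp only [pr]
    rw [if_pos (by omega), if_pos (by omega)]
    apply SimpleGraph.Adj.symm
    convert this using 2 <;> omega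
  · rw [if_neg hti]
    refine ⟨ht1, fun hc => ht2 ?_⟩
    by_cases he : t = i
    · subst he
      have := h1 hc
      simpa [pr] using this
    · simp only [pr]
      rw [if_neg (by omega), if_neg (by omega)]
      exact h2 t (by omega) he hc

lemma pr_st (h : St d S N G p) (hr : Rlz d G') {i : ℕ} (hi : i + 1 < N)
    (h1 : G.Adj (p i) (p (i + 1)) → G'.Adj (p 0) (p (i + 1)))
    (h2 : ∀ t, t + 1 < N → t ≠ i → G.Adj (p t) (p (t + 1)) → G'.Adj (p t) (p (t + 1))) :
    St d S N G' (pr i p) := by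
  obtain ⟨ho1, ho2⟩ := pr_ord h hi
  exact h.of_le hr ho1 ho2 (card_le_card_of_injOn _ (pr_maps hi h1 h2) pr_inj)

lemma rot (h : St d S N G p) {i : ℕ} (hi : i + 1 < N) (ha : G.Adj (p 0) (p (i + 1))) :
    G.Adj (p i) (p (i + 1)) ∧ St d S N G (pr i p) := by
  refine ⟨?_, pr_st h h.rlz hi (fun _ => ha) (fun _ _ _ h => h)⟩
  by_contra hc
  obtain ⟨ho1, ho2⟩ := pr_ord h hi
  have hle := h.min G _ h.rlz ho1 ho2
  have h3 : (gapS G N (pr i p)).card ≤ ((gapS G N p).erase i).card := by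
    apply card_le_card_of_injOn _ _ (pr_inj (i := i))
    intro t ht
    simp only [mem_coe] at *
    rw [mem_erase]
    refine ⟨?_, pr_maps hi (fun _ => ha) (fun _ _ _ h => h) t ht⟩
    intro he
    have ht : t = i := by split_ifs at he <;> omega
    subst ht
    rw [mem_gapS] at ht
    apply ht.2
    simpa [pr] using ha
  have h4 : i ∈ gapS G N p := mem_gapS.2 ⟨by omega, hc⟩
  rw [card_erase_of_mem h4] at h3
  have := card_pos.2 ⟨i, h4⟩
  omega

lemma disj (hN : 3 ≤ N) (hnh : NoHam d S N) (h : St d S N G p) {i : ℕ} (hi : i + 1 < N)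
    (ha : G.Adj (p 0) (p (i + 1))) : ¬ G.Adj (p (N - 1)) (p i) := by
  have := (rot h hi ha).2.close hN hnh
  simpa [pr, show ¬ (N - 1 ≤ i) by omega] using this

/-- suffix reversal -/
def sr (N j : ℕ) (p : ℕ → V) (t : ℕ) : V := if t ≤ j then p t else p (N + j - t)

lemma srot (h : St d S N G p) {j : ℕ} (hj : j + 1 < N) (ha : G.Adj (p (N - 1)) (p j)) :
    G.Adj (p j) (p (j + 1)) ∧ St d S N G (sr N j p) := by
  have hr := h.rev
  obtain ⟨h1, h2⟩ := rot hr (i := N - 2 - j) (by omega) (by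
    simp only [rv]; convert ha using 2 <;> omega)
  constructor
  · simp only [rv] at h1
    apply SimpleGraph.Adj.symm
    convert h1 using 2 <;> omega
  · refine h2.rev.of_eq ?_
    intro t ht
    simp only [sr, rv, pr]
    split_ifs
    · omega
    · congr 1; omega
    · congr 1; omega
    · omega

lemma sw1 (hN : 3 ≤ N) (hnh : NoHam d S N) (h : St d S N G p) {x y : V}
    (hx : G.Adj (p 0) x) (hx1 : x ≠ p 1) (hy : G.Adj (p (N - 1)) y) (hy1 : y ≠ p (N - 2))
    (hxy : x ≠ y) : G.Adj x y := by
  by_contra hc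
  have hcl := h.close hN hnh
  have hb0 : p 0 ≠ p (N - 1) := fun he => by have := h.inj _ (by omega) _ (by omega) he; omega
  have hR : Rlz d (sw G (p 0) x (p (N - 1)) y) := by
    apply sw_rlz h.rlz hx hy (fun h => hcl h.symm) hc hb0 hxy
    · rintro rfl; exact hcl hy
    · rintro rfl; exact hcl hx.symm
  have hst : St d S N (sw G (p 0) x (p (N - 1)) y) p := by
    apply h.of_le hR h.mem h.inj
    apply card_le_card
    intro t ht
    rw [mem_gapS] at *
    refine ⟨ht.1, fun ha => ht.2 ?_⟩
    rw [sw_adj]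
    refine ⟨ha.ne, Or.inl ⟨ha, ?_, ?_, ?_, ?_⟩⟩
    · rintro ⟨h1, h2⟩
      have := h.inj _ (by omega) _ (by omega) h1
      subst this
      exact hx1 h2.symm
    · rintro ⟨h1, h2⟩
      have := h.inj _ (by omega) _ (by omega) h2
      omega
    · rintro ⟨h1, h2⟩
      have := h.inj _ (by omega) _ (by omega) h1
      omega
    · rintro ⟨h1, h2⟩
      have := h.inj _ (by omega) _ (by omega) h2
      have h3 : t = N - 2 := by omega
      subst h3
      exact hy1 h1.symm
  refine hst.close hN hnh ?_
  rw [sw_adj]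
  exact ⟨hb0.symm, by tauto⟩

lemma sw4 (h : St d S N G p) {i : ℕ} (hi1 : 1 ≤ i) (hi : i + 1 < N) {x : V}
    (hx : G.Adj (p 0) x) (hx1 : x ≠ p 1) (hxi : ¬ G.Adj x (p i)) (hxi' : x ≠ p i) :
    ∃ G', St d S N G' (pr i p) ∧
      (∀ u v, G'.Adj u v → G.Adj u v ∨ (u = p 0 ∧ v = p (i + 1)) ∨ (u = p (i + 1) ∧ v = p 0) ∨
        (u = x ∧ v = p i) ∨ (u = p i ∧ v = x)) ∧
      (∀ u v, G.Adj u v → G'.Adj u v ∨ (u = p 0 ∧ v = x) ∨ (u = x ∧ v = p 0) ∨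
        (u = p i ∧ v = p (i + 1)) ∨ (u = p (i + 1) ∧ v = p i)) := by
  by_cases ha : G.Adj (p 0) (p (i + 1))
  · exact ⟨G, (rot h hi ha).2, fun u v h => Or.inl h, fun u v h => Or.inl h⟩
  by_cases hg : G.Adj (p i) (p (i + 1))
  · have n1 : p 0 ≠ p (i + 1) := fun he => by have := h.inj _ (by omega) _ (by omega) he; omega
    have n3 : p 0 ≠ p i := fun he => by have := h.inj _ (by omega) _ (by omega) he; omega
    have n4 : x ≠ p (i + 1) := by rintro rfl; exact ha hx
    refine ⟨sw G (p 0) x (p (i + 1)) (p i), ?_, ?_, ?_⟩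
    · have hR : Rlz d (sw G (p 0) x (p (i + 1)) (p i)) :=
        sw_rlz h.rlz hx hg.symm ha hxi n1 hxi' n3 n4
      apply pr_st h hR hi
      · intro _; rw [sw_adj]; exact ⟨n1, by tauto⟩
      · intro t ht hti hadj
        rw [sw_adj]
        refine ⟨hadj.ne, Or.inl ⟨hadj, ?_, ?_, ?_, ?_⟩⟩
        · rintro ⟨h1, h2⟩
          have := h.inj _ (by omega) _ (by omega) h1
          subst this
          exact hx1 h2.symm
        · rintro ⟨h1, h2⟩
          have := h.inj _ (by omega) _ (by omega) h2
          omega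
        · rintro ⟨h1, h2⟩
          have := h.inj _ (by omega) _ (by omega) h1
          have := h.inj _ (by omega) _ (by omega) h2
          omega
        · rintro ⟨h1, h2⟩
          have := h.inj _ (by omega) _ (by omega) h1
          omega
    · intro u v huv
      rw [sw_adj] at huv
      exact huv.2.imp (fun h => h.1) id
    · intro u v huv
      rw [sw_adj]
      by_contra hcon
      simp only [not_or] at hcon
      obtain ⟨h1, h2, h3, h4, h5⟩ := hcon
      exact h1 ⟨huv.ne, Or.inl ⟨huv, h2, h3, h5, h4⟩⟩
  · exact ⟨G, pr_st h h.rlz hi (fun h => absurd h hg) (fun _ _ _ h => h),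
      fun u v h => Or.inl h, fun u v h => Or.inl h⟩

/-- a minimal state exists -/
lemma exists_st {G₀ : SimpleGraph V} (h₀ : Rlz d G₀) {p₀ : ℕ → V} (hm : ∀ i < N, p₀ i ∈ S)
    (hi : ∀ i < N, ∀ j < N, p₀ i = p₀ j → i = j) : ∃ G p, St d S N G p ∧
    ∀ G' p', St d S N G' p' → d (p' 0) + d (p' (N - 1)) ≤ d (p 0) + d (p (N - 1)) := by
  have h1 : ∃ k, ∃ G p, Rlz d G ∧ (∀ i < N, p i ∈ S) ∧
    (∀ i < N, ∀ j < N, p i = p j → i = j) ∧ (gapS G N p).card = k := ⟨_, G₀, p₀, h₀, hm, hi, rfl⟩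
  obtain ⟨G₁, p₁, hr, hm1, hi1, hc⟩ := Nat.find_spec h1
  have hst : St d S N G₁ p₁ := by
    refine ⟨hr, hm1, hi1, fun G' p' a b c => ?_⟩
    rw [hc]
    exact Nat.find_min' h1 ⟨G', p', a, b, c, rfl⟩
  have h2 : ∃ k, ∃ G p, St d S N G p ∧ 2 * (∑ v, d v) - (d (p 0) + d (p (N - 1))) = k :=
    ⟨_, G₁, p₁, hst, rfl⟩
  obtain ⟨G, p, hs, hk⟩ := Nat.find_spec h2
  refine ⟨G, p, hs, fun G' p' hs' => ?_⟩
  have h3 := Nat.find_min' h2 ⟨G', p', hs', rfl⟩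
  rw [← hk] at h3
  have hle : ∀ v, d v ≤ ∑ v, d v := fun v => single_le_sum (f := d) (by simp) (mem_univ v)
  have := hle (p 0); have := hle (p (N-1)); have := hle (p' 0); have := hle (p' (N-1))
  omega

lemma exists_ord (hc : S.card = N) (hN : 0 < N) : ∃ p : ℕ → V, (∀ i < N, p i ∈ S) ∧
    (∀ i < N, ∀ j < N, p i = p j → i = j) := by
  subst hc
  let e := S.equivFin.symm
  refine ⟨fun i => if h : i < S.card then (e ⟨i, h⟩ : V) else (e ⟨0, hN⟩ : V), ?_, ?_⟩
  · intro i hi; simp [hi]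
  · intro i hi j hj h; simpa [hi, hj, Subtype.ext_iff] using h

end

section

variable {d : V → ℕ} {S : Finset V} {N : ℕ} {G G' : SimpleGraph V} {p p' : ℕ → V}

/-- minimal state with maximal end degree sum -/
structure MM (d : V → ℕ) (S : Finset V) (N : ℕ) (G : SimpleGraph V) (p : ℕ → V) : Prop where
  st : St d S N G p
  max : ∀ G' p', St d S N G' p' → d (p' 0) + d (p' (N - 1)) ≤ d (p 0) + d (p (N - 1))

lemma MM.rev (h : MM d S N G p) : MM d S N G (rv N p) := by
  refine ⟨h.st.rev, fun G' p' h' => ?_⟩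
  have := h.max G' p' h'
  have e1 : rv N p 0 = p (N - 1) := rfl
  have e2 : rv N p (N - 1) = p 0 := by simp [rv]
  rw [e1, e2]; omega

lemma MM.E1 (h : MM d S N G p) {i : ℕ} (hi : i + 1 < N) (ha : G.Adj (p 0) (p (i + 1))) :
    d (p i) ≤ d (p 0) := by
  have := h.max _ _ (rot h.st hi ha).2
  simp [pr, show ¬ (N - 1 ≤ i) by omega] at this
  exact this

lemma MM.E1' (h : MM d S N G p) {j : ℕ} (hj : j + 1 < N) (ha : G.Adj (p (N - 1)) (p j)) :
    d (p (j + 1)) ≤ d (p (N - 1)) := by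
  have := h.rev.E1 (i := N - 2 - j) (by omega) (by
    simp only [rv]; convert ha using 2 <;> omega)
  simp only [rv] at this
  rw [show N - 1 - (N - 2 - j) = j + 1 by omega, Nat.sub_zero] at this
  exact this

lemma MM.E2 (h : MM d S N G p) {i : ℕ} (hi1 : 1 ≤ i) (hi : i + 1 < N) {x : V}
    (hx : G.Adj (p 0) x) (hx1 : x ≠ p 1) (hxi : ¬ G.Adj x (p i)) (hxi' : x ≠ p i) :
    d (p i) ≤ d (p 0) := by
  obtain ⟨G', h1, -, -⟩ := sw4 h.st hi1 hi hx hx1 hxi hxi'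
  have := h.max _ _ h1
  simp [pr, show ¬ (N - 1 ≤ i) by omega] at this
  exact this

lemma count_low (h : St d S N G p) (T : Finset ℕ) (k : ℕ) (hT : ∀ t ∈ T, t < N ∧ d (p t) ≤ k) :
    T.card ≤ (S.filter (fun s => d s ≤ k)).card := by
  rw [← card_image_of_injOn (f := p) (s := T)]
  · apply card_le_card
    intro v hv
    rw [mem_image] at hv
    obtain ⟨t, ht, rfl⟩ := hv
    rw [mem_filter]
    exact ⟨h.mem t (hT t ht).1, (hT t ht).2⟩
  · intro i hi j hj he
    exact h.inj i (hT i hi).1 j (hT j hj).1 he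

/-- index set of the neighbours of the first vertex, shifted -/
def II (G : SimpleGraph V) (N : ℕ) (p : ℕ → V) : Finset ℕ :=
  (range (N - 1)).filter (fun i => G.Adj (p 0) (p (i + 1)))

def JJ (G : SimpleGraph V) (N : ℕ) (p : ℕ → V) : Finset ℕ :=
  (range (N - 1)).filter (fun i => G.Adj (p (N - 1)) (p i))

lemma mem_II {i : ℕ} : i ∈ II G N p ↔ i < N - 1 ∧ G.Adj (p 0) (p (i + 1)) := by simp [II]
lemma mem_JJ {i : ℕ} : i ∈ JJ G N p ↔ i < N - 1 ∧ G.Adj (p (N - 1)) (p i) := by simp [JJ]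

lemma card_II (h : St d S N G p) (hc : S.card = N) (hsub : nb G (p 0) ⊆ S) :
    d (p 0) ≤ (II G N p).card := by
  rw [← h.rlz]
  refine le_trans (card_le_card (t := (II G N p).image (fun i => p (i + 1))) ?_) card_image_le
  intro v hv
  obtain ⟨i, hi, rfl⟩ := ord_surj hc h.mem h.inj v (hsub hv)
  rw [mem_nb] at hv
  have : i ≠ 0 := by rintro rfl; exact G.irrefl hv
  rw [mem_image]
  refine ⟨i - 1, ?_, by congr 1; omega⟩
  rw [mem_II, show i - 1 + 1 = i by omega]
  exact ⟨by omega, hv⟩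

lemma card_JJ (h : St d S N G p) (hc : S.card = N) (hsub : nb G (p (N - 1)) ⊆ S) :
    d (p (N - 1)) ≤ (JJ G N p).card := by
  rw [← h.rlz]
  refine le_trans (card_le_card (t := (JJ G N p).image p) ?_) card_image_le
  intro v hv
  obtain ⟨i, hi, rfl⟩ := ord_surj hc h.mem h.inj v (hsub hv)
  rw [mem_nb] at hv
  have : i ≠ N - 1 := by rintro rfl; exact G.irrefl hv
  rw [mem_image]
  refine ⟨i, ?_, rfl⟩
  rw [mem_JJ]
  exact ⟨by omega, hv⟩

lemma II_JJ_disj (hN : 3 ≤ N) (hnh : NoHam d S N) (h : St d S N G p) :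
    Disjoint (II G N p) (JJ G N p) := by
  rw [disjoint_left]
  intro t ht ht'
  rw [mem_II] at ht
  rw [mem_JJ] at ht'
  exact disj hN hnh h (by omega) ht.2 ht'.2

lemma II_JJ_card (hN : 3 ≤ N) (hnh : NoHam d S N) (h : St d S N G p) :
    (II G N p).card + (JJ G N p).card ≤ N - 1 := by
  rw [← card_union_of_disjoint (II_JJ_disj hN hnh h)]
  have : II G N p ∪ JJ G N p ⊆ range (N - 1) := by
    intro t ht; simp only [mem_union, mem_II, mem_JJ] at ht; simp; tauto
  simpa using card_le_card this

lemma low_count (h : MM d S N G p) (hc : S.card = N) (hN : 3 ≤ N)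
    (H1 : ∀ s ∈ S, ∀ o, o ∉ S → d o ≤ d s) (hk : 2 * d (p 0) ≤ N) :
    d (p 0) ≤ (S.filter (fun s => d s ≤ d (p 0))).card := by
  by_cases hsub : nb G (p 0) ⊆ S
  · refine (card_II h.st hc hsub).trans (count_low h.st _ _ ?_)
    intro t ht
    rw [mem_II] at ht
    exact ⟨by omega, h.E1 (by omega) ht.2⟩
  · obtain ⟨x, hx, hxS⟩ := not_subset.1 hsub
    rw [mem_nb] at hx
    have hxp : ∀ i < N, x ≠ p i := by rintro i hi rfl; exact hxS (h.st.mem i hi)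
    have hdx := H1 (p 0) (h.st.mem 0 (by omega)) x hxS
    set B := (Icc 1 (N - 2)).filter (fun i => G.Adj x (p i)) with hB
    set T := insert 0 ((Icc 1 (N - 2)).filter (fun i => ¬ G.Adj x (p i))) with hT
    have h1 : B.card + ((Icc 1 (N - 2)).filter (fun i => ¬ G.Adj x (p i))).card = N - 2 := by
      rw [hB, card_filter_add_card_filter_not]; simp
    have h2 : T.card = ((Icc 1 (N - 2)).filter (fun i => ¬ G.Adj x (p i))).card + 1 := by
      rw [hT, card_insert_of_notMem (by simp)]
    have h3 : B.card + 1 ≤ d x := by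
      rw [← h.st.rlz x, ← card_image_of_injOn (f := p) (s := B)]
      · rw [← card_insert_of_notMem (a := p 0)]
        · apply card_le_card
          intro v hv
          rw [mem_insert, mem_image] at hv
          rcases hv with rfl | ⟨t, ht, rfl⟩
          · simpa using hx.symm
          · simp [hB] at ht; simpa using ht.2
        · rw [mem_image]
          rintro ⟨t, ht, he⟩
          simp [hB] at ht
          have := h.st.inj _ (by omega) _ (by omega) he
          omega
      · intro i hi j hj he
        simp [hB] at hi hj
        exact h.st.inj _ (by omega) _ (by omega) he
    have h4 : T.card ≤ (S.filter (fun s => d s ≤ d (p 0))).card := by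
      apply count_low h.st
      intro t ht
      simp only [hT, mem_insert, mem_filter, mem_Icc] at ht
      rcases ht with rfl | ⟨ht1, ht2⟩
      · exact ⟨by omega, le_rfl⟩
      · exact ⟨by omega, h.E2 ht1.1 (by omega) hx (hxp 1 (by omega)) ht2 (hxp t (by omega))⟩
    omega

/-- Pósa-type statement, all neighbours in `S` -/
lemma posa {G₀ : SimpleGraph V} (h₀ : Rlz d G₀) (hc : S.card = N) (hN : 3 ≤ N)
    (hout : ∀ o, o ∉ S → d o = 0)
    (H : ∀ k, 1 ≤ k → 2 * k < N → (S.filter (fun s => d s ≤ k)).card < k) :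
    ∃ G p, Rlz d G ∧ HamC G S N p := by
  by_contra hcon
  push Not at hcon
  have hnh : NoHam d S N := hcon
  obtain ⟨p₀, h1, h2⟩ := exists_ord hc (by omega)
  obtain ⟨G, p, hs, hm⟩ := exists_st h₀ h1 h2
  have hMM : MM d S N G p := ⟨hs, hm⟩
  have H1 : ∀ s ∈ S, ∀ o, o ∉ S → d o ≤ d s := by
    intro s _ o ho; rw [hout o ho]; omega
  have hin : ∀ v, nb G v ⊆ S := by
    intro v u hu
    by_contra hS
    have := hs.rlz u
    rw [hout u hS, card_eq_zero, eq_empty_iff_forall_notMem] at this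
    rw [mem_nb] at hu
    exact this v (by simpa using hu.symm)
  have key : ∀ q, MM d S N G q → N ≤ 2 * d (q 0) := by
    intro q hq
    by_contra hlt
    have h3 := low_count hq hc hN H1 (by omega)
    by_cases h0 : d (q 0) = 0
    · have h5 := H 1 le_rfl (by omega)
      have : 0 < (S.filter (fun s => d s ≤ 1)).card :=
        card_pos.2 ⟨q 0, by simp [hq.st.mem 0 (by omega), h0]⟩
      omega
    · have := H (d (q 0)) (by omega) (by omega)
      omega
  have k1 := key p hMM
  have k2 := key _ hMM.rev
  have e1 : rv N p 0 = p (N - 1) := rfl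
  rw [e1] at k2
  have := card_II hs hc (hin _)
  have := card_JJ hs hc (hin _)
  have := II_JJ_card hN hnh hs
  omega

set_option maxHeartbeats 1000000 in
lemma inside {m : ℕ} (hm : 4 ≤ m) (hNm : N = 2 * m - 1) (hc : S.card = N) (hnh : NoHam d S N)
    (h : MM d S N G p) (hk : m - 1 ≤ d (p 0)) (hl : m - 1 ≤ d (p (N - 1)))
    (hs0 : nb G (p 0) ⊆ S) (hs1 : nb G (p (N - 1)) ⊆ S)
    (H3 : (S.filter (fun s => d s ≤ m - 1)).card ≤ m - 1 ∨ (∃ w ∈ S, d w = m) ∨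
      ∀ s ∈ S, d s ≤ m - 1) : False := by
  have hN : 3 ≤ N := by omega
  have hst := h.st
  have c1 := card_II hst hc hs0
  have c2 := card_JJ hst hc hs1
  have c3 := II_JJ_card hN hnh hst
  have hdk : d (p 0) = m - 1 := by omega
  have hdl : d (p (N - 1)) = m - 1 := by omega
  have hne : ∀ i < N, ∀ j < N, i ≠ j → p i ≠ p j := fun i hi j hj hij he =>
    hij (hst.inj i hi j hj he)
  have hU : II G N p ∪ JJ G N p = range (N - 1) := by
    apply eq_of_subset_of_card_le
    · intro t ht; simp only [mem_union, mem_II, mem_JJ] at ht; simp; tauto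
    · rw [card_union_of_disjoint (II_JJ_disj hN hnh hst)]; simp; omega
  have hor : ∀ t, t < N - 1 → G.Adj (p 0) (p (t + 1)) ∨ G.Adj (p (N - 1)) (p t) := by
    intro t ht
    have : t ∈ II G N p ∪ JJ G N p := by rw [hU]; simpa using ht
    rw [mem_union, mem_II, mem_JJ] at this
    tauto
  have hnb : ∀ t, t < N - 1 → ¬ (G.Adj (p 0) (p (t + 1)) ∧ G.Adj (p (N - 1)) (p t)) :=
    fun t ht hh => disj hN hnh hst (by omega) hh.1 hh.2
  have hcl := hst.close hN hnh
  have hcl' : ¬ G.Adj (p 0) (p (N - 1)) := fun h => hcl h.symm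
  have a01 : G.Adj (p 0) (p 1) := by
    rcases hor 0 (by omega) with h | h
    · exact h
    · exact absurd h hcl
  have ab : G.Adj (p (N - 1)) (p (N - 2)) := by
    rcases hor (N - 2) (by omega) with h | h
    · rw [show N - 2 + 1 = N - 1 by omega] at h; exact absurd h hcl'
    · exact h
  have lowI : ∀ t, t < N - 1 → G.Adj (p 0) (p (t + 1)) → d (p t) ≤ m - 1 := by
    intro t ht ha; rw [← hdk]; exact h.E1 (by omega) ha
  have lowJ : ∀ t, t < N - 1 → G.Adj (p (N - 1)) (p t) → d (p (t + 1)) ≤ m - 1 := by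
    intro t ht ha; rw [← hdl]; exact h.E1' (by omega) ha
  set X := (nb G (p 0)).erase (p 1) with hX
  set Y := (nb G (p (N - 1))).erase (p (N - 2)) with hY
  have cX : X.card = m - 2 := by
    rw [hX, card_erase_of_mem (by simpa using a01), hst.rlz, hdk]; omega
  have cY : Y.card = m - 2 := by
    rw [hY, card_erase_of_mem (by simpa using ab), hst.rlz, hdl]; omega
  have mX : ∀ v, v ∈ X ↔ v ≠ p 1 ∧ G.Adj (p 0) v := by intro v; simp [hX]
  have mY : ∀ v, v ∈ Y ↔ v ≠ p (N - 2) ∧ G.Adj (p (N - 1)) v := by intro v; simp [hY]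
  have hXY : ∀ x ∈ X, ∀ y ∈ Y, x ≠ y → G.Adj x y := by
    intro x hx y hy hxy
    rw [mX] at hx; rw [mY] at hy
    exact sw1 hN hnh hst hx.2 hx.1 hy.2 hy.1 hxy
  -- indices
  have iX : ∀ x ∈ X, ∃ i, 1 ≤ i ∧ i + 1 ≤ N - 2 ∧ x = p (i + 1) ∧ G.Adj (p 0) (p (i + 1)) := by
    intro x hx
    rw [mX] at hx
    obtain ⟨i, hi, rfl⟩ := ord_surj hc hst.mem hst.inj x (hs0 (by simpa using hx.2))
    have e0 : i ≠ 0 := by rintro rfl; exact G.irrefl hx.2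
    have e1 : i ≠ 1 := by rintro rfl; exact hx.1 rfl
    have e2 : i ≠ N - 1 := by rintro rfl; exact hcl' hx.2
    refine ⟨i - 1, by omega, by omega, by congr 1; omega, ?_⟩
    rw [show i - 1 + 1 = i by omega]; exact hx.2
  have iY : ∀ y ∈ Y, ∃ j, 1 ≤ j ∧ j + 1 ≤ N - 2 ∧ y = p j ∧ G.Adj (p (N - 1)) (p j) := by
    intro x hx
    rw [mY] at hx
    obtain ⟨i, hi, rfl⟩ := ord_surj hc hst.mem hst.inj x (hs1 (by simpa using hx.2))
    have e0 : i ≠ 0 := by rintro rfl; exact hcl hx.2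
    have e1 : i ≠ N - 2 := by rintro rfl; exact hx.1 rfl
    have e2 : i ≠ N - 1 := by rintro rfl; exact G.irrefl hx.2
    exact ⟨i, by omega, by omega, rfl, hx.2⟩
  have p0X : p 0 ∉ X := by rw [mX]; exact fun h => G.irrefl h.2
  have p0Y : p 0 ∉ Y := by rw [mY]; exact fun h => hcl h.2
  have bX : p (N - 1) ∉ X := by rw [mX]; exact fun h => hcl' h.2
  have bY : p (N - 1) ∉ Y := by rw [mY]; exact fun h => G.irrefl h.2
  have n0b : p 0 ≠ p (N - 1) := hne _ (by omega) _ (by omega) (by omega)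
  have dY : ∀ y ∈ Y, m ≤ d y := by
    intro y hy
    obtain ⟨j, j1, j2, rfl, ha⟩ := iY y hy
    have e1 := (srot hst (by omega) ha).1
    have e2 : p (j + 1) ∉ X := by
      rw [mX]; exact fun hh => hnb j (by omega) ⟨hh.2, ha⟩
    have e3 : p (j + 1) ≠ p (N - 1) := hne _ (by omega) _ (by omega) (by omega)
    have e4 : p 0 ≠ p (j + 1) := hne _ (by omega) _ (by omega) (by omega)
    rw [← hst.rlz]
    by_cases hjX : p j ∈ X
    · have hsub : insert (p 0) (insert (p (N - 1)) (insert (p (j + 1)) (X.erase (p j)))) ⊆ nb G (p j) := by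
        intro v hv
        simp only [mem_insert, mem_erase] at hv
        rw [mem_nb]
        rcases hv with rfl | rfl | rfl | hv
        · exact ((mX _).1 hjX).2.symm
        · exact ha.symm
        · exact e1
        · exact (hXY v hv.2 _ hy hv.1).symm
      have := card_le_card hsub
      rw [card_insert_of_notMem (by simp [n0b, e4, p0X]), card_insert_of_notMem (by simp [e3.symm, bX]),
        card_insert_of_notMem (by simp [e2]), card_erase_of_mem hjX] at this
      omega
    · have hsub : (insert (p (N - 1)) (insert (p (j + 1)) X)) ⊆ nb G (p j) := by
        intro v hv
        simp only [mem_insert] at hv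
        rw [mem_nb]
        rcases hv with rfl | rfl | hv
        · exact ha.symm
        · exact e1
        · exact (hXY v hv _ hy (by rintro rfl; exact hjX hv)).symm
      have := card_le_card hsub
      rw [card_insert_of_notMem (by simp [e3.symm, bX]),
        card_insert_of_notMem (by simp [e2])] at this
      omega
  have dX : ∀ x ∈ X, m ≤ d x := by
    intro x hx
    obtain ⟨i, i1, i2, rfl, ha⟩ := iX x hx
    have e1 := (rot hst (by omega) ha).1
    have e2 : p i ∉ Y := by
      rw [mY]; exact fun hh => hnb i (by omega) ⟨ha, hh.2⟩
    have e3 : p i ≠ p (N - 1) := hne _ (by omega) _ (by omega) (by omega)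
    have e4 : p 0 ≠ p i := hne _ (by omega) _ (by omega) (by omega)
    rw [← hst.rlz]
    by_cases hjX : p (i + 1) ∈ Y
    · have hsub : insert (p 0) (insert (p (N - 1)) (insert (p i) (Y.erase (p (i + 1))))) ⊆ nb G (p (i + 1)) := by
        intro v hv
        simp only [mem_insert, mem_erase] at hv
        rw [mem_nb]
        rcases hv with rfl | rfl | rfl | hv
        · exact ha.symm
        · exact ((mY _).1 hjX).2.symm
        · exact e1.symm
        · exact (hXY _ hx v hv.2 (Ne.symm hv.1))
      have := card_le_card hsub
      rw [card_insert_of_notMem (by simp [n0b, e4, p0Y]), card_insert_of_notMem (by simp [e3.symm, bY]),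
        card_insert_of_notMem (by simp [e2]), card_erase_of_mem hjX] at this
      omega
    · have hsub : (insert (p 0) (insert (p i) Y)) ⊆ nb G (p (i + 1)) := by
        intro v hv
        simp only [mem_insert] at hv
        rw [mem_nb]
        rcases hv with rfl | rfl | hv
        · exact ha.symm
        · exact e1.symm
        · exact (hXY _ hx v hv (by rintro rfl; exact hjX hv))
      have := card_le_card hsub
      rw [card_insert_of_notMem (by simp [e4, p0Y]),
        card_insert_of_notMem (by simp [e2])] at this
      omega
  rcases H3 with H3 | ⟨w, hw, hdw⟩ | H3
  · have := count_low hst (insert (N - 1) (II G N p)) (m - 1) (by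
      intro t ht
      rw [mem_insert, mem_II] at ht
      rcases ht with rfl | ht
      · exact ⟨by omega, hdl.le⟩
      · exact ⟨by omega, lowI t ht.1 ht.2⟩)
    rw [card_insert_of_notMem (by rw [mem_II]; omega)] at this
    omega
  · obtain ⟨t, ht, rfl⟩ := ord_surj hc hst.mem hst.inj w hw
    have t0 : t ≠ 0 := by rintro rfl; omega
    have t1 : t ≠ N - 1 := by rintro rfl; omega
    have tI : ¬ G.Adj (p 0) (p (t + 1)) := fun ha => by
      have := lowI t (by omega) ha; omega
    have tJ : G.Adj (p (N - 1)) (p t) := (hor t (by omega)).resolve_left tI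
    have sJ : ¬ G.Adj (p (N - 1)) (p (t - 1)) := fun ha => by
      have := lowJ (t - 1) (by omega) ha
      rw [show t - 1 + 1 = t by omega] at this; omega
    have sI : G.Adj (p 0) (p t) := by
      have := (hor (t - 1) (by omega)).resolve_right sJ
      rwa [show t - 1 + 1 = t by omega] at this
    have f1 : G.Adj (p t) (p (t + 1)) := (srot hst (by omega) tJ).1
    have f2 : G.Adj (p (t - 1)) (p t) := by
      have := (rot hst (i := t - 1) (by omega) (by rwa [show t - 1 + 1 = t by omega])).1
      rwa [show t - 1 + 1 = t by omega] at this
    have g1 : p (t + 1) ∉ X := by rw [mX]; exact fun hh => tI hh.2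
    have g2 : p (t - 1) ∉ Y := by rw [mY]; exact fun hh => sJ hh.2
    have n1 : p 0 ≠ p (t + 1) := hne _ (by omega) _ (by omega) (by omega)
    have n2 : p (t - 1) ≠ p (N - 1) := hne _ (by omega) _ (by omega) (by omega)
    have n3 : p (t - 1) ≠ p (t + 1) := hne _ (by omega) _ (by omega) (by omega)
    by_cases ht1 : t = 1
    · subst ht1
      have n4 : p (N - 1) ≠ p (1 + 1) := hne _ (by omega) _ (by omega) (by omega)
      have hy : p 1 ∈ Y := by rw [mY]; exact ⟨hne _ (by omega) _ (by omega) (by omega), tJ⟩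
      have hsub : insert (p 0) (insert (p (N - 1)) (insert (p (1 + 1)) X)) ⊆ nb G (p 1) := by
        intro v hv
        simp only [mem_insert] at hv
        rw [mem_nb]
        rcases hv with rfl | rfl | rfl | hv
        · exact sI.symm
        · exact tJ.symm
        · exact f1
        · exact (hXY v hv _ hy ((mX v).1 hv).1).symm
      have := card_le_card hsub
      rw [card_insert_of_notMem (by simp only [mem_insert, not_or]; exact ⟨n0b, n1, p0X⟩),
        card_insert_of_notMem (by simp only [mem_insert, not_or]; exact ⟨n4, bX⟩),
        card_insert_of_notMem g1, hst.rlz] at this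
      omega
    have hx : p t ∈ X := by rw [mX]; exact ⟨hne _ (by omega) _ (by omega) (by omega), sI⟩
    have n4 : p 0 ≠ p (t - 1) := hne _ (by omega) _ (by omega) (by omega)
    by_cases ht2 : t = N - 2
    · have hsub : insert (p 0) (insert (p (N - 1)) (insert (p (t - 1)) Y)) ⊆ nb G (p t) := by
        intro v hv
        simp only [mem_insert] at hv
        rw [mem_nb]
        rcases hv with rfl | rfl | rfl | hv
        · exact sI.symm
        · exact tJ.symm
        · exact f2.symm
        · exact (hXY _ hx v hv (by rw [ht2]; exact Ne.symm ((mY v).1 hv).1))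
      have := card_le_card hsub
      rw [card_insert_of_notMem (by simp only [mem_insert, not_or]; exact ⟨n0b, n4, p0Y⟩),
        card_insert_of_notMem (by simp only [mem_insert, not_or]; exact ⟨n2.symm, bY⟩),
        card_insert_of_notMem g2, hst.rlz] at this
      omega
    have hy : p t ∈ Y := by rw [mY]; exact ⟨hne _ (by omega) _ (by omega) (by omega), tJ⟩
    have n5 : p (N - 1) ≠ p (t + 1) := hne _ (by omega) _ (by omega) (by omega)
    have g3 : p (t - 1) ∉ X := by
      intro hh
      have := dX _ hh
      have := lowI (t - 1) (by omega) (by rwa [show t - 1 + 1 = t by omega])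
      omega
    have hsub : insert (p 0) (insert (p (N - 1)) (insert (p (t - 1)) (insert (p (t + 1)) (X.erase (p t)))))
        ⊆ nb G (p t) := by
      intro v hv
      simp only [mem_insert, mem_erase] at hv
      rw [mem_nb]
      rcases hv with rfl | rfl | rfl | rfl | hv
      · exact sI.symm
      · exact tJ.symm
      · exact f2.symm
      · exact f1
      · exact (hXY v hv.2 _ hy hv.1).symm
    have := card_le_card hsub
    rw [card_insert_of_notMem (by simp only [mem_insert, mem_erase, not_or]; exact ⟨n0b, n4, n1, fun h => p0X h.2⟩),
      card_insert_of_notMem (by simp only [mem_insert, mem_erase, not_or]; exact ⟨n2.symm, n5, fun h => bX h.2⟩),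
      card_insert_of_notMem (by simp only [mem_insert, mem_erase, not_or]; exact ⟨n3, fun h => g3 h.2⟩),
      card_insert_of_notMem (by simp only [mem_erase]; exact fun h => g1 h.2), card_erase_of_mem hx, hst.rlz] at this
    omega
  · obtain ⟨y, hy⟩ := card_pos.1 (show 0 < Y.card by omega)
    have h1 := dY y hy
    have h2 := H3 y (hs1 (by rw [mY] at hy; simpa using hy.2))
    omega

end

section

variable {d : V → ℕ} {S : Finset V} {N : ℕ} {G G' : SimpleGraph V} {p p' : ℕ → V}

lemma out (hN : 3 ≤ N) (hnh : NoHam d S N) (H1 : ∀ s ∈ S, ∀ o, o ∉ S → d o ≤ d s)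
    (h : St d S N G p) {x : V} (hx : G.Adj (p 0) x) (hxS : x ∉ S) :
    G.Adj (p (N - 1)) (p (N - 2)) ∧ d x = d (p (N - 1)) ∧
    ∀ v, G.Adj x v ↔ (v = p 0 ∨ (v ≠ x ∧ v ≠ p (N - 2) ∧ G.Adj (p (N - 1)) v) ∨
      (v = p (N - 1) ∧ G.Adj x (p (N - 1)))) := by
  have hxp : ∀ i < N, x ≠ p i := by rintro i hi rfl; exact hxS (h.mem i hi)
  have hcl := h.close hN hnh
  have n0b : p 0 ≠ p (N - 1) := fun he => by have := h.inj _ (by omega) _ (by omega) he; omega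
  set Y := (nb G (p (N - 1))).erase (p (N - 2)) with hY
  have mY : ∀ v, v ∈ Y ↔ v ≠ p (N - 2) ∧ G.Adj (p (N - 1)) v := by intro v; simp [hY]
  have p0Y : p 0 ∉ Y := by rw [mY]; exact fun h => hcl h.2
  have bY : p (N - 1) ∉ Y := by rw [mY]; exact fun h => G.irrefl h.2
  have hxY : ∀ y ∈ Y, x ≠ y → G.Adj x y := by
    intro y hy hxy
    rw [mY] at hy
    exact sw1 hN hnh h hx (hxp 1 (by omega)) hy.2 hy.1 hxy
  have hd := H1 _ (h.mem (N - 1) (by omega)) x hxS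
  have hYc : d (p (N - 1)) ≤ Y.card + 1 ∧ (¬ G.Adj (p (N - 1)) (p (N - 2)) → d (p (N - 1)) ≤ Y.card) := by
    rw [← h.rlz (p (N - 1))]
    have : (nb G (p (N - 1))).card - 1 ≤ Y.card := pred_card_le_card_erase
    refine ⟨by omega, fun hc => ?_⟩
    rw [hY, erase_eq_of_notMem (by simpa using hc)]
  have fin : ∀ T : Finset V, T ⊆ nb G x → Y.card + 1 ≤ T.card →
      G.Adj (p (N - 1)) (p (N - 2)) ∧ d x = d (p (N - 1)) ∧ T = nb G x := by
    intro T hT hc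
    have h1 := card_le_card hT
    have hdx := h.rlz x
    have hadj : G.Adj (p (N - 1)) (p (N - 2)) := by
      by_contra hcon
      have := hYc.2 hcon
      omega
    refine ⟨hadj, by omega, eq_of_subset_of_card_le hT (by omega)⟩
  by_cases hxb : G.Adj x (p (N - 1))
  · have hxY' : x ∈ Y := by rw [mY]; exact ⟨hxp _ (by omega), hxb.symm⟩
    obtain ⟨f1, f2, f3⟩ := fin (insert (p 0) (insert (p (N - 1)) (Y.erase x))) (by
        intro v hv
        simp only [mem_insert, mem_erase] at hv
        rw [mem_nb]
        rcases hv with rfl | rfl | hv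
        · exact hx.symm
        · exact hxb
        · exact hxY v hv.2 (Ne.symm hv.1)) (by
        rw [card_insert_of_notMem (by
            simp only [mem_insert, mem_erase, not_or]; exact ⟨n0b, fun h => p0Y h.2⟩),
          card_insert_of_notMem (by simp only [mem_erase]; exact fun h => bY h.2),
          card_erase_of_mem hxY']
        have := card_pos.2 ⟨x, hxY'⟩
        omega)
    refine ⟨f1, f2, fun v => ?_⟩
    rw [← mem_nb, ← f3]
    simp only [mem_insert, mem_erase, mY, hxb, and_true]
    tauto
  · have hxY' : x ∉ Y := by rw [mY]; exact fun h => hxb h.2.symm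
    obtain ⟨f1, f2, f3⟩ := fin (insert (p 0) Y) (by
        intro v hv
        simp only [mem_insert] at hv
        rw [mem_nb]
        rcases hv with rfl | hv
        · exact hx.symm
        · exact hxY v hv (by rintro rfl; exact hxY' hv)) (by
        rw [card_insert_of_notMem p0Y])
    refine ⟨f1, f2, fun v => ?_⟩
    rw [← mem_nb, ← f3]
    simp only [mem_insert, mY, hxb, and_false, or_false]
    have : v ∈ Y → v ≠ x := by rintro hv rfl; exact hxY' hv
    rw [mY] at this
    tauto

lemma rout (hN : 3 ≤ N) (hnh : NoHam d S N) (H1 : ∀ s ∈ S, ∀ o, o ∉ S → d o ≤ d s)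
    (h : St d S N G p) {x : V} (hx : G.Adj (p (N - 1)) x) (hxS : x ∉ S) :
    ∀ v, G.Adj x v ↔ (v = p (N - 1) ∨ (v ≠ x ∧ v ≠ p 1 ∧ G.Adj (p 0) v) ∨
      (v = p 0 ∧ G.Adj x (p 0))) := by
  have := (out hN hnh H1 h.rev (x := x) hx hxS).2.2
  have e1 : rv N p 0 = p (N - 1) := rfl
  have e2 : rv N p (N - 1) = p 0 := by simp [rv]
  have e3 : rv N p (N - 2) = p 1 := by simp only [rv]; congr 1; omega
  rw [e1, e2, e3] at this
  exact this

lemma sout (hN : 3 ≤ N) (hnh : NoHam d S N) (H1 : ∀ s ∈ S, ∀ o, o ∉ S → d o ≤ d s)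
    (h : St d S N G p) {x : V} (hx : G.Adj (p 0) x) (hxS : x ∉ S) {j : ℕ} (hj : j + 3 ≤ N)
    (ha : G.Adj (p (N - 1)) (p j)) : G.Adj (p (j + 1)) (p (j + 2)) ∧ d x = d (p (j + 1)) ∧
    ∀ v, G.Adj x v ↔ (v = p 0 ∨ (v ≠ x ∧ v ≠ p (j + 2) ∧ G.Adj (p (j + 1)) v) ∨
      (v = p (j + 1) ∧ G.Adj x (p (j + 1)))) := by
  have h2 := (srot h (by omega) ha).2
  have e1 : sr N j p 0 = p 0 := by simp [sr]
  have e2 : sr N j p (N - 1) = p (j + 1) := by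
    simp only [sr, show ¬ (N - 1 ≤ j) by omega, if_false]; congr 1; omega
  have e3 : sr N j p (N - 2) = p (j + 2) := by
    simp only [sr, show ¬ (N - 2 ≤ j) by omega, if_false]; congr 1; omega
  have := out hN hnh H1 h2 (x := x) (by rw [e1]; exact hx) hxS
  rw [e1, e2, e3] at this
  exact this

lemma case2 (hN : 7 ≤ N) (hc : S.card = N) (hnh : NoHam d S N)
    (H1 : ∀ s ∈ S, ∀ o, o ∉ S → d o ≤ d s)
    (h : St d S N G p) {x : V} (hx : G.Adj (p 0) x) (hxS : x ∉ S) (hxb : G.Adj (p (N - 1)) x) :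
    (∀ v, G.Adj (p 0) v → v ≠ p 1 → v ∉ S) ∧ (∀ v, G.Adj (p (N - 1)) v → v ≠ p (N - 2) → v ∉ S) := by
  have hxp : ∀ i < N, x ≠ p i := by rintro i hi rfl; exact hxS (h.mem i hi)
  have hne : ∀ i < N, ∀ j < N, i ≠ j → p i ≠ p j := fun i hi j hj hij he =>
    hij (h.inj i hi j hj he)
  have hcl := h.close (by omega) hnh
  have o1 := (out (by omega) hnh H1 h hx hxS).2.2
  have o2 := rout (by omega) hnh H1 h hxb hxS
  have key : ∀ i, 0 < i → i < N - 1 → ¬ G.Adj x (p i) := by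
    intro i hi0 hi1 ha
    have a1 := (o1 (p i)).1 ha
    have a2 := (o2 (p i)).1 ha
    have a1' : p i ≠ p (N - 2) ∧ G.Adj (p (N - 1)) (p i) := by
      rcases a1 with a | a | a
      · exact absurd a (hne _ (by omega) _ (by omega) (by omega))
      · exact a.2
      · exact absurd a.1 (hne _ (by omega) _ (by omega) (by omega))
    have a2' : p i ≠ p 1 ∧ G.Adj (p 0) (p i) := by
      rcases a2 with a | a | a
      · exact absurd a (hne _ (by omega) _ (by omega) (by omega))
      · exact a.2
      · exact absurd a.1 (hne _ (by omega) _ (by omega) (by omega))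
    have hi2 : i ≠ N - 2 := by rintro rfl; exact a1'.1 rfl
    have o3 := (sout (by omega) hnh H1 h hx hxS (j := i) (by omega) a1'.2).2.2
    have hn : ¬ G.Adj x (p (i + 1)) := by
      intro hh
      rcases (o2 _).1 hh with a | a | a
      · exact absurd a (hne _ (by omega) _ (by omega) (by omega))
      · exact disj (by omega) hnh h (by omega) a.2.2 a1'.2
      · exact absurd a.1 (hne _ (by omega) _ (by omega) (by omega))
    rcases (o3 (p (N - 1))).1 hxb.symm with a | a | a
    · exact absurd a (hne _ (by omega) _ (by omega) (by omega))
    · have hi3 : i + 2 ≠ N - 1 := by rintro hh; rw [hh] at a; exact a.2.1 rfl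
      apply hn
      rw [o1]
      right; left
      exact ⟨(hxp _ (by omega)).symm, hne _ (by omega) _ (by omega) (by omega), a.2.2.symm⟩
    · exact hn a.2
  constructor
  · intro v hv hv1 hvS
    obtain ⟨i, hi, rfl⟩ := ord_surj hc h.mem h.inj v hvS
    have i0 : i ≠ 0 := by rintro rfl; exact G.irrefl hv
    have i1 : i ≠ N - 1 := by rintro rfl; exact hcl hv.symm
    refine key i (by omega) (by omega) ?_
    rw [o2]
    exact Or.inr (Or.inl ⟨(hxp i hi).symm, hv1, hv⟩)
  · intro v hv hv1 hvS
    obtain ⟨i, hi, rfl⟩ := ord_surj hc h.mem h.inj v hvS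
    have i0 : i ≠ 0 := by rintro rfl; exact hcl hv
    have i1 : i ≠ N - 1 := by rintro rfl; exact G.irrefl hv
    refine key i (by omega) (by omega) ?_
    rw [o1]
    exact Or.inr (Or.inl ⟨(hxp i hi).symm, hv1, hv⟩)

lemma case3 (hN : 7 ≤ N) (hc : S.card = N) (hnh : NoHam d S N)
    (H1 : ∀ s ∈ S, ∀ o, o ∉ S → d o ≤ d s)
    (h : St d S N G p) {x y : V} (hx : G.Adj (p 0) x) (hxS : x ∉ S) (hxb : ¬ G.Adj x (p (N - 1)))
    (hy : G.Adj (p (N - 1)) y) (hyS : y ∉ S) (hy0 : ¬ G.Adj y (p 0)) :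
    ∀ v, G.Adj (p (N - 1)) v → v ≠ p (N - 2) → v ∉ S := by
  have hyp : ∀ i < N, y ≠ p i := by rintro i hi rfl; exact hyS (h.mem i hi)
  have hne : ∀ i < N, ∀ j < N, i ≠ j → p i ≠ p j := fun i hi j hj hij he =>
    hij (h.inj i hi j hj he)
  have hcl := h.close (by omega) hnh
  intro v hv hv1 hvS
  obtain ⟨i, hi, rfl⟩ := ord_surj hc h.mem h.inj v hvS
  have i0 : i ≠ 0 := by rintro rfl; exact hcl hv
  have i1 : i ≠ N - 1 := by rintro rfl; exact G.irrefl hv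
  have i2 : i ≠ N - 2 := by rintro rfl; exact hv1 rfl
  have o1 := (out (by omega) hnh H1 h hx hxS).2.2
  have o2 := rout (by omega) hnh H1 h hy hyS
  have o3 := (sout (by omega) hnh H1 h hx hxS (j := i) (by omega) hv).2.2
  have hxy : G.Adj x y := by
    rw [o1]
    exact Or.inr (Or.inl ⟨by rintro rfl; exact hxb hy.symm, hyp _ (by omega), hy⟩)
  rcases (o3 y).1 hxy with a | a | a
  · exact hyp _ (by omega) a
  · rcases (o2 _).1 a.2.2.symm with b | b | b
    · exact absurd b (hne _ (by omega) _ (by omega) (by omega))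
    · exact disj (by omega) hnh h (by omega) b.2.2 hv
    · exact hy0 b.2
  · exact hyp _ (by omega) a.1

lemma final (hN : 7 ≤ N) (hc : S.card = N) (hnh : NoHam d S N)
    (H1 : ∀ s ∈ S, ∀ o, o ∉ S → d o ≤ d s)
    (h : St d S N G p) {x y : V} (hx : G.Adj (p 0) x) (hxS : x ∉ S)
    (hy : G.Adj (p (N - 1)) y) (hyS : y ∉ S) (h3 : 3 ≤ d (p 2))
    (hX : ∀ v, G.Adj (p 0) v → v ≠ p 1 → v ∉ S)
    (hY : ∀ v, G.Adj (p (N - 1)) v → v ≠ p (N - 2) → v ∉ S) : False := by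
  have hxp : ∀ i < N, x ≠ p i := by rintro i hi rfl; exact hxS (h.mem i hi)
  have hyp : ∀ i < N, y ≠ p i := by rintro i hi rfl; exact hyS (h.mem i hi)
  have hne : ∀ i < N, ∀ j < N, i ≠ j → p i ≠ p j := fun i hi j hj hij he =>
    hij (h.inj i hi j hj he)
  have o2 := rout (by omega) hnh H1 h hy hyS
  have hp2 : p 2 ∈ S := h.mem 2 (by omega)
  -- outside neighbours of `p 0` are not adjacent to `p 2`
  have hx2 : ∀ x, G.Adj (p 0) x → x ∉ S → ¬ G.Adj x (p 2) := by
    intro x hx hxS ha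
    have o1 := (out (by omega) hnh H1 h hx hxS).2.2
    rcases (o1 _).1 ha with a | a | a
    · exact absurd a (hne _ (by omega) _ (by omega) (by omega))
    · exact hY _ a.2.2 a.2.1 hp2
    · exact absurd a.1 (hne _ (by omega) _ (by omega) (by omega))
  obtain ⟨G', hs, g1, g2⟩ := sw4 h (i := 2) (by omega) (by omega) hx (hxp 1 (by omega))
    (hx2 x hx hxS) (hxp 2 (by omega))
  obtain ⟨z, hz⟩ : ∃ z, z ∈ ((nb G (p 2)).erase (p 1)).erase (p 3) := by
    apply card_pos.1
    have a1 := pred_card_le_card_erase (s := nb G (p 2)) (a := p 1)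
    have a2 := pred_card_le_card_erase (s := (nb G (p 2)).erase (p 1)) (a := p 3)
    rw [h.rlz] at a1
    omega
  simp only [mem_erase, mem_nb] at hz
  obtain ⟨hz3, hz1, hz⟩ := hz
  have hz' : G'.Adj (p 2) z := by
    rcases g2 _ _ hz with a | a | a | a | a
    · exact a
    · exact absurd a.1 (hne _ (by omega) _ (by omega) (by omega))
    · exact absurd a.1.symm (hxp _ (by omega))
    · exact absurd a.2 hz3
    · exact absurd a.1 (hne _ (by omega) _ (by omega) (by omega))
  have hy' : G'.Adj (p (N - 1)) y := by
    rcases g2 _ _ hy with a | a | a | a | a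
    · exact a
    · exact absurd a.1 (hne _ (by omega) _ (by omega) (by omega))
    · exact absurd a.2 (hyp _ (by omega))
    · exact absurd a.2 (hyp _ (by omega))
    · exact absurd a.2 (hyp _ (by omega))
  have e0 : pr 2 p 0 = p 2 := by simp [pr]
  have e1 : pr 2 p 1 = p 1 := by simp [pr]
  have e2 : pr 2 p (N - 1) = p (N - 1) := by simp [pr, show ¬ (N - 1 ≤ 2) by omega]
  have e3 : pr 2 p (N - 2) = p (N - 2) := by simp [pr]; intro; omega
  have hy2 : ¬ G.Adj y (p 2) := by
    intro ha
    rcases (o2 _).1 ha with a | a | a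
    · exact absurd a (hne _ (by omega) _ (by omega) (by omega))
    · exact hX _ a.2.2 a.2.1 hp2
    · exact absurd a.1 (hne _ (by omega) _ (by omega) (by omega))
  have hzy : z ≠ y := by rintro rfl; exact hy2 hz.symm
  have hadj := sw1 (by omega) hnh hs (x := z) (y := y) (by rw [e0]; exact hz') (by rw [e1]; exact hz1)
    (by rw [e2]; exact hy') (by rw [e3]; exact hyp _ (by omega)) hzy
  have hG : G.Adj z y := by
    rcases g1 _ _ hadj with a | a | a | a | a
    · exact a
    · exact absurd a.2 (hyp _ (by omega))
    · exact absurd a.2 (hyp _ (by omega))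
    · exact absurd a.2 (hyp _ (by omega))
    · exact absurd a.1.symm hz.ne
  rcases (o2 _).1 hG.symm with a | a | a
  · rw [a] at hz
    exact hY _ hz.symm (hne _ (by omega) _ (by omega) (by omega)) hp2
  · exact hx2 z a.2.2 (hX _ a.2.2 a.2.1) hz.symm
  · rw [a.1] at hz
    exact hX _ hz.symm (hne _ (by omega) _ (by omega) (by omega)) hp2

end

section

variable {d : V → ℕ} {S : Finset V} {N : ℕ} {G G' : SimpleGraph V} {p p' : ℕ → V}

lemma three {v a b c : V} (hd : (nb G v).card = 3) (ha : G.Adj v a) (hb : G.Adj v b)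
    (hc : G.Adj v c) (hab : a ≠ b) (hac : a ≠ c) (hbc : b ≠ c) :
    ∀ u, G.Adj v u → u = a ∨ u = b ∨ u = c := by
  have h : ({a, b, c} : Finset V) = nb G v := by
    apply eq_of_subset_of_card_le
    · intro u hu
      simp only [mem_insert, mem_singleton] at hu
      rw [mem_nb]
      rcases hu with rfl | rfl | rfl <;> assumption
    · rw [hd, card_eq_three.2 ⟨a, b, c, hab, hac, hbc, rfl⟩]
  intro u hu
  rw [← mem_nb, ← h] at hu
  simpa using hu

lemma five {v a b c e f : V} (ha : G.Adj v a) (hb : G.Adj v b) (hc : G.Adj v c) (he : G.Adj v e)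
    (hf : G.Adj v f) (hn : [a, b, c, e, f].Nodup) : 5 ≤ (nb G v).card := by
  have h : [a, b, c, e, f].toFinset ⊆ nb G v := by
    intro u hu
    simp only [List.mem_toFinset, List.mem_cons, List.not_mem_nil, or_false] at hu
    rw [mem_nb]
    rcases hu with rfl | rfl | rfl | rfl | rfl <;> assumption
  have := card_le_card h
  rw [List.toFinset_card_of_nodup hn] at this
  simpa using this

/-- the final configuration with `m = 4` -/
lemma case1_end {a0 a1 a2 a3 a4 a5 a6 x y : V} (hr : Rlz d G)
    (hn : [a0, a1, a2, a3, a4, a5, a6, x, y].Nodup)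
    (hm : ∀ v ∈ [a0, a1, a2, a3, a4, a5, a6], v ∈ S)
    (h12 : G.Adj a1 a2) (h34 : G.Adj a3 a4) (h45 : G.Adj a4 a5) (h56 : G.Adj a5 a6)
    (h61 : G.Adj a6 a1) (h0x : G.Adj a0 x) (h0y : G.Adj a0 y) (h32 : G.Adj a3 a2)
    (n03 : ¬ G.Adj a0 a3) (nx2 : ¬ G.Adj x a2) (n02 : ¬ G.Adj a0 a2) (nxy : ¬ G.Adj y x) :
    ¬ NoHam d S 7 := by
  intro hnh
  simp only [List.nodup_cons, List.mem_cons, List.not_mem_nil, or_false, not_or,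
    List.nodup_nil, and_true, not_false_eq_true] at hn
  obtain ⟨⟨n01, n02', n03', n04, n05, n06, n0x, n0y⟩, ⟨n12, n13, n14, n15, n16, n1x, n1y⟩,
    ⟨n23, n24, n25, n26, n2x, n2y⟩, ⟨n34, n35, n36, n3x, n3y⟩, ⟨n45, n46, n4x, n4y⟩,
    ⟨n56, n5x, n5y⟩, ⟨n6x, n6y⟩, nxy'⟩ := hn
  have r1 := sw_rlz hr h0x h32 n03 nx2 n03' (Ne.symm n2x) n02' (Ne.symm n3x)
  have r2 := sw_rlz r1 (a := a0) (b := y) (c := a2) (e := x)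
    (by rw [sw_adj]; refine ⟨n0y, Or.inl ⟨h0y, ?_, ?_, ?_, ?_⟩⟩ <;> rintro ⟨e1, e2⟩ <;> grind)
    (by rw [sw_adj]; grind)
    (by rw [sw_adj]; grind)
    (by rw [sw_adj]; grind) n02' (Ne.symm nxy') n0x (Ne.symm n2y)
  let q : ℕ → V := fun i => match i with
    | 0 => a1 | 1 => a2 | 2 => a0 | 3 => a3 | 4 => a4 | 5 => a5 | _ => a6
  refine hnh _ q r2 ⟨?_, ?_, ?_, ?_⟩
  · intro i hi
    apply hm
    interval_cases i <;> simp [q]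
  · intro i hi j hj he
    interval_cases i <;> interval_cases j <;> simp only [q] at he <;> first | rfl | grind
  · intro i hi
    have : i < 6 := by omega
    clear hi
    interval_cases i <;> simp only [q, sw_adj] <;> grind
  · simp only [q, sw_adj]
    grind

end

section

variable {d : V → ℕ} {S : Finset V} {N : ℕ} {G G' : SimpleGraph V} {p p' : ℕ → V}

lemma case1_four (hc : S.card = 7) (hnh : NoHam d S 7)
    (H1 : ∀ s ∈ S, ∀ o, o ∉ S → d o ≤ d s)
    (h : St d S 7 G p) {x : V} (hx : G.Adj (p 0) x) (hxS : x ∉ S) (hxb : ¬ G.Adj x (p 6))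
    (hs1 : nb G (p 6) ⊆ S) (hb1 : G.Adj (p 6) (p 1)) (hb4 : G.Adj (p 6) (p 4)) (hb3 : d (p 6) = 3)
    (H3 : (S.filter (fun s => d s ≤ 3)).card ≤ 3 ∨ (∃ w ∈ S, d w = 4) ∨
      ∀ s ∈ S, d s ≤ 3) : False := by
  have hne : ∀ i < 7, ∀ j < 7, i ≠ j → p i ≠ p j := fun i hi j hj hij he =>
    hij (h.inj i hi j hj he)
  have n01 := hne 0 (by omega) 1 (by omega) (by omega)
  have n02 := hne 0 (by omega) 2 (by omega) (by omega)
  have n03 := hne 0 (by omega) 3 (by omega) (by omega)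
  have n04 := hne 0 (by omega) 4 (by omega) (by omega)
  have n05 := hne 0 (by omega) 5 (by omega) (by omega)
  have n06 := hne 0 (by omega) 6 (by omega) (by omega)
  have n12 := hne 1 (by omega) 2 (by omega) (by omega)
  have n13 := hne 1 (by omega) 3 (by omega) (by omega)
  have n14 := hne 1 (by omega) 4 (by omega) (by omega)
  have n15 := hne 1 (by omega) 5 (by omega) (by omega)
  have n16 := hne 1 (by omega) 6 (by omega) (by omega)
  have n23 := hne 2 (by omega) 3 (by omega) (by omega)
  have n24 := hne 2 (by omega) 4 (by omega) (by omega)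
  have n25 := hne 2 (by omega) 5 (by omega) (by omega)
  have n26 := hne 2 (by omega) 6 (by omega) (by omega)
  have n34 := hne 3 (by omega) 4 (by omega) (by omega)
  have n35 := hne 3 (by omega) 5 (by omega) (by omega)
  have n36 := hne 3 (by omega) 6 (by omega) (by omega)
  have n45 := hne 4 (by omega) 5 (by omega) (by omega)
  have n46 := hne 4 (by omega) 6 (by omega) (by omega)
  have n56 := hne 5 (by omega) 6 (by omega) (by omega)
  have hSp : ∀ z, z ∉ S → ∀ i < 7, z ≠ p i := by rintro z hz i hi rfl; exact hz (h.mem i hi)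
  have hxp := hSp x hxS
  obtain ⟨b5, dx, o1⟩ := out (by omega) hnh H1 h hx hxS
  simp only [show 7 - 1 = 6 from rfl, show 7 - 2 = 5 from rfl] at b5 dx o1
  have t6 := three ((h.rlz _).trans hb3) b5 hb1 hb4 (Ne.symm n15) (Ne.symm n45) n14
  have x1 : G.Adj x (p 1) := by
    rw [o1]; exact Or.inr (Or.inl ⟨(hxp 1 (by omega)).symm, n15, hb1⟩)
  have x4 : G.Adj x (p 4) := by
    rw [o1]; exact Or.inr (Or.inl ⟨(hxp 4 (by omega)).symm, n45, hb4⟩)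
  have tx := three ((h.rlz _).trans (dx.trans hb3)) hx.symm x1 x4 n01 n04 n14
  -- generic consequence of `sout`
  have gen : ∀ q : ℕ → V, St d S 7 G q → q 0 = p 0 → ∀ j, j + 3 ≤ 7 → G.Adj (q 6) (q j) →
      q (j + 1) ≠ p 1 → q (j + 1) ≠ p 4 → q (j + 2) ≠ p 1 → q (j + 2) ≠ p 4 →
      q (j + 1) ≠ p 0 →
      G.Adj (q (j + 1)) (q (j + 2)) ∧ d (q (j + 1)) = 3 ∧ G.Adj (q (j + 1)) (p 1) ∧
      G.Adj (q (j + 1)) (p 4) := by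
    intro q hq h0 j hj ha m1 m4 k1 k4 m0
    obtain ⟨s1, s2, s3⟩ := sout (by omega) hnh H1 hq (x := x) (by rw [h0]; exact hx) hxS hj ha
    refine ⟨s1, by omega, ?_, ?_⟩
    · rcases (s3 _).1 x1 with a | a | a
      · rw [h0] at a; exact absurd a.symm n01
      · exact a.2.2
      · exact absurd a.1.symm m1
    · rcases (s3 _).1 x4 with a | a | a
      · rw [h0] at a; exact absurd a.symm n04
      · exact a.2.2
      · exact absurd a.1.symm m4
  obtain ⟨e23, d2, e21, e24⟩ := gen p h rfl 1 (by omega) hb1 (Ne.symm n12) n24 (Ne.symm n13) n34 (Ne.symm n02)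
  obtain ⟨e56, d5, e51, e54⟩ := gen p h rfl 4 (by omega) hb4 (Ne.symm n15) (Ne.symm n45) (Ne.symm n16) (Ne.symm n46) (Ne.symm n05)
  have hq := (srot h (j := 1) (by omega) hb1).2
  obtain ⟨e32, d3, e31, e34⟩ := gen (sr 7 1 p) hq (by simp [sr]) 4 (by omega)
    (by simpa [sr] using e24) (by simpa [sr] using Ne.symm n13) (by simpa [sr] using n34)
    (by simpa [sr] using Ne.symm n12) (by simpa [sr] using n24) (by simpa [sr] using Ne.symm n03)
  simp only [sr, show ¬ (4 + 1 ≤ 1) by omega, show ¬ (4 + 2 ≤ 1) by omega, if_false,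
    show 7 + 1 - (4 + 1) = 3 by omega, show 7 + 1 - (4 + 2) = 2 by omega] at e32 d3 e31 e34
  simp only [show 1 + 1 = 2 from rfl, show 1 + 2 = 3 from rfl, show 4 + 1 = 5 from rfl,
    show 4 + 2 = 6 from rfl] at e23 d2 e21 e24 e56 d5 e51 e54
  have t2 := three ((h.rlz _).trans d2) e21 e23 e24 n13 n14 n34
  have t3 := three ((h.rlz _).trans d3) e31 e32 e34 n12 n14 n24
  have t5 := three ((h.rlz _).trans d5) e51 e56 e54 n16 n14 (Ne.symm n46)
  have f1 : 5 ≤ d (p 1) := by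
    rw [← h.rlz]
    refine five e21.symm e31.symm e51.symm hb1.symm x1.symm ?_
    simp only [List.nodup_cons, List.mem_cons, List.not_mem_nil, or_false, not_or,
      List.nodup_nil, and_true, not_false_eq_true]
    exact ⟨⟨n23, n25, n26, (hxp 2 (by omega)).symm⟩, ⟨n35, n36, (hxp 3 (by omega)).symm⟩,
      ⟨n56, (hxp 5 (by omega)).symm⟩, (hxp 6 (by omega)).symm⟩
  have f4 : 5 ≤ d (p 4) := by
    rw [← h.rlz]
    refine five e24.symm e34.symm e54.symm hb4.symm x4.symm ?_
    simp only [List.nodup_cons, List.mem_cons, List.not_mem_nil, or_false, not_or,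
      List.nodup_nil, and_true, not_false_eq_true]
    exact ⟨⟨n23, n25, n26, (hxp 2 (by omega)).symm⟩, ⟨n35, n36, (hxp 3 (by omega)).symm⟩,
      ⟨n56, (hxp 5 (by omega)).symm⟩, (hxp 6 (by omega)).symm⟩
  rcases H3 with H3 | H3 | H3
  · have hsub : ({p 2, p 3, p 5, p 6} : Finset V) ⊆ S.filter (fun s => d s ≤ 3) := by
      intro v hv
      simp only [mem_insert, mem_singleton] at hv
      rw [mem_filter]
      rcases hv with rfl | rfl | rfl | rfl
      · exact ⟨h.mem _ (by omega), by omega⟩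
      · exact ⟨h.mem _ (by omega), by omega⟩
      · exact ⟨h.mem _ (by omega), by omega⟩
      · exact ⟨h.mem _ (by omega), by omega⟩
    have := card_le_card hsub
    rw [card_insert_of_notMem (by simp [n23, n25, n26]), card_insert_of_notMem (by simp [n35, n36]),
      card_insert_of_notMem (by simp [n56]), card_singleton] at this
    omega
  · obtain ⟨w, hw, hdw⟩ := H3
    obtain ⟨i, hi, rfl⟩ := ord_surj hc h.mem h.inj w hw
    have i0 : d (p 0) = 4 := by
      interval_cases i <;> first | assumption | omega
    obtain ⟨y, hy⟩ : ∃ y, y ∈ nb G (p 0) \ {p 1, p 4, x} := by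
      apply card_pos.1
      have := le_card_sdiff ({p 1, p 4, x} : Finset V) (nb G (p 0))
      rw [h.rlz, i0] at this
      have h3 : ({p 1, p 4, x} : Finset V).card ≤ 3 := card_le_three
      omega
    simp only [mem_sdiff, mem_nb, mem_insert, mem_singleton, not_or] at hy
    obtain ⟨hy0, hy1, hy4, hyx⟩ := hy
    have c02 : ¬ G.Adj (p 0) (p 2) := fun a => by
      rcases t2 _ a.symm with b | b | b
      exacts [n01 b, n03 b, n04 b]
    have c03 : ¬ G.Adj (p 0) (p 3) := fun a => by
      rcases t3 _ a.symm with b | b | b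
      exacts [n01 b, n02 b, n04 b]
    have c05 : ¬ G.Adj (p 0) (p 5) := fun a => by
      rcases t5 _ a.symm with b | b | b
      exacts [n01 b, n06 b, n04 b]
    have c06 : ¬ G.Adj (p 0) (p 6) := fun a => by
      rcases t6 _ a.symm with b | b | b
      exacts [n05 b, n01 b, n04 b]
    have hyS : y ∉ S := by
      intro hyS
      obtain ⟨i, hi, rfl⟩ := ord_surj hc h.mem h.inj y hyS
      interval_cases i
      · exact G.irrefl hy0
      · exact hy1 rfl
      · exact c02 hy0
      · exact c03 hy0
      · exact hy4 rfl
      · exact c05 hy0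
      · exact c06 hy0
    have hyp := hSp y hyS
    have nyx : ¬ G.Adj y x := fun a => by
      rcases tx _ a.symm with b | b | b
      exacts [hyp 0 (by omega) b, hyp 1 (by omega) b, hyp 4 (by omega) b]
    have nx2 : ¬ G.Adj x (p 2) := fun a => by
      rcases tx _ a with b | b | b
      exacts [n02 b.symm, n12 b.symm, n24 b]
    refine case1_end (S := S) h.rlz (a0 := p 0) (a1 := p 1) (a2 := p 2) (a3 := p 3) (a4 := p 4)
      (a5 := p 5) (a6 := p 6) (x := x) (y := y) ?_ ?_ e21.symm e34 e54.symm e56 hb1 hx hy0 e32 c03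
      nx2 c02 nyx hnh
    · simp only [List.nodup_cons, List.mem_cons, List.not_mem_nil, or_false, not_or,
        List.nodup_nil, and_true, not_false_eq_true]
      exact ⟨⟨n01, n02, n03, n04, n05, n06, (hxp 0 (by omega)).symm, (hyp 0 (by omega)).symm⟩,
        ⟨n12, n13, n14, n15, n16, (hxp 1 (by omega)).symm, (hyp 1 (by omega)).symm⟩,
        ⟨n23, n24, n25, n26, (hxp 2 (by omega)).symm, (hyp 2 (by omega)).symm⟩,
        ⟨n34, n35, n36, (hxp 3 (by omega)).symm, (hyp 3 (by omega)).symm⟩,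
        ⟨n45, n46, (hxp 4 (by omega)).symm, (hyp 4 (by omega)).symm⟩,
        ⟨n56, (hxp 5 (by omega)).symm, (hyp 5 (by omega)).symm⟩,
        ⟨(hxp 6 (by omega)).symm, (hyp 6 (by omega)).symm⟩, Ne.symm hyx⟩
    · intro v hv
      simp only [List.mem_cons, List.not_mem_nil, or_false] at hv
      rcases hv with rfl | rfl | rfl | rfl | rfl | rfl | rfl <;> exact h.mem _ (by omega)
  · have := H3 _ (h.mem 1 (by omega))
    omega

lemma case1 {m : ℕ} (hm : 4 ≤ m) (hNm : N = 2 * m - 1) (hc : S.card = N) (hnh : NoHam d S N)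
    (H1 : ∀ s ∈ S, ∀ o, o ∉ S → d o ≤ d s)
    (h : St d S N G p) (hl : m - 1 ≤ d (p (N - 1)))
    {x : V} (hx : G.Adj (p 0) x) (hxS : x ∉ S) (hxb : ¬ G.Adj x (p (N - 1)))
    (hs1 : nb G (p (N - 1)) ⊆ S)
    (H3 : (S.filter (fun s => d s ≤ m - 1)).card ≤ m - 1 ∨ (∃ w ∈ S, d w = m) ∨
      ∀ s ∈ S, d s ≤ m - 1) : False := by
  have hxp : ∀ i < N, x ≠ p i := by rintro i hi rfl; exact hxS (h.mem i hi)
  have hne : ∀ i < N, ∀ j < N, i ≠ j → p i ≠ p j := fun i hi j hj hij he =>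
    hij (h.inj i hi j hj he)
  have hcl := h.close (by omega) hnh
  have o1 := (out (by omega) hnh H1 h hx hxS).2.2
  set J := (Icc 1 (N - 3)).filter (fun j => G.Adj (p (N - 1)) (p j)) with hJ
  have mJ : ∀ j, j ∈ J ↔ (1 ≤ j ∧ j ≤ N - 3) ∧ G.Adj (p (N - 1)) (p j) := by
    intro j; rw [hJ, mem_filter, mem_Icc]
  have cJ : d (p (N - 1)) ≤ J.card + 1 := by
    rw [← h.rlz]
    have hsub : nb G (p (N - 1)) ⊆ insert (p (N - 2)) (J.image p) := by
      intro v hv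
      have hvS := hs1 hv
      rw [mem_nb] at hv
      obtain ⟨i, hi, rfl⟩ := ord_surj hc h.mem h.inj v hvS
      have i0 : i ≠ 0 := by rintro rfl; exact hcl hv
      have i1 : i ≠ N - 1 := by rintro rfl; exact G.irrefl hv
      by_cases i2 : i = N - 2
      · rw [i2]; exact mem_insert_self _ _
      · exact mem_insert_of_mem (mem_image_of_mem p ((mJ i).2 ⟨by omega, hv⟩))
    exact (card_le_card hsub).trans ((card_insert_le _ _).trans (by
      have := card_image_le (s := J) (f := p)
      omega))
  have k1 : ∀ j ∈ J, j + 1 ∉ J := by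
    intro j hj hj1
    rw [mJ] at hj hj1
    have o3 := (sout (by omega) hnh H1 h hx hxS (j := j) (by omega) hj.2).2.2
    apply hxb
    rw [o3]
    exact Or.inr (Or.inl ⟨(hxp _ (by omega)).symm, hne _ (by omega) _ (by omega) (by omega),
      hj1.2.symm⟩)
  have k2 : ∀ j ∈ J, j + 2 ∉ J := by
    intro j hj hj1
    rw [mJ] at hj hj1
    have o3 := (sout (by omega) hnh H1 h hx hxS (j := j) (by omega) hj.2).2.2
    have hxa : G.Adj x (p (j + 2)) := by
      rw [o1]
      exact Or.inr (Or.inl ⟨(hxp _ (by omega)).symm, hne _ (by omega) _ (by omega) (by omega),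
        hj1.2⟩)
    rcases (o3 _).1 hxa with a | a | a
    · exact absurd a (hne _ (by omega) _ (by omega) (by omega))
    · exact a.2.1 rfl
    · exact absurd a.1 (hne _ (by omega) _ (by omega) (by omega))
  have sp : ∀ i ∈ J, ∀ j ∈ J, i < j → i + 3 ≤ j := by
    intro i hi j hj hij
    have a1 := k1 i hi
    have a2 := k2 i hi
    have : j ≠ i + 1 := by rintro rfl; exact a1 hj
    have : j ≠ i + 2 := by rintro rfl; exact a2 hj
    omega
  have cc : J.card ≤ (range ((N - 4) / 3 + 1)).card := by
    apply card_le_card_of_injOn (fun j => (j - 1) / 3)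
    · intro j hj
      have := (mJ j).1 hj
      simp only [coe_range, Set.mem_Iio]
      omega
    · intro i hi j hj he
      have a1 := (mJ i).1 hi
      have a2 := (mJ j).1 hj
      have a3 := sp i hi j hj
      have a4 := sp j hj i hi
      dsimp only at he
      omega
  rw [card_range] at cc
  have m4 : m = 4 := by clear H3; omega
  subst m4
  have N7 : N = 7 := by omega
  subst N7
  have hJ2 : 1 < J.card := by omega
  obtain ⟨i, hi, j, hj, hij⟩ := one_lt_card.1 hJ2
  have a1 := (mJ i).1 hi
  have a2 := (mJ j).1 hj
  have a3 := sp i hi j hj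
  have a4 := sp j hj i hi
  have : 1 ∈ J ∧ 4 ∈ J := by
    rcases (show (i = 1 ∧ j = 4) ∨ (i = 4 ∧ j = 1) by omega) with ⟨rfl, rfl⟩ | ⟨rfl, rfl⟩
    · exact ⟨hi, hj⟩
    · exact ⟨hj, hi⟩
  exact case1_four hc hnh H1 h hx hxS hxb hs1 ((mJ 1).1 this.1).2 ((mJ 4).1 this.2).2
    (show d (p 6) = 3 by
      simp only [show 7 - 1 = 6 from rfl] at hl cJ
      omega) H3

lemma outside {m : ℕ} (hm : 4 ≤ m) (hNm : N = 2 * m - 1) (hc : S.card = N) (hnh : NoHam d S N)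
    (H1 : ∀ s ∈ S, ∀ o, o ∉ S → d o ≤ d s)
    (h : St d S N G p) (hl : m - 1 ≤ d (p (N - 1)))
    {x : V} (hx : G.Adj (p 0) x) (hxS : x ∉ S)
    (H3 : (S.filter (fun s => d s ≤ m - 1)).card ≤ m - 1 ∨ (∃ w ∈ S, d w = m) ∨
      ∀ s ∈ S, d s ≤ m - 1) : False := by
  have h3 : 3 ≤ d (p 2) := by
    have a1 := (out (by omega) hnh H1 h hx hxS).2.1
    have a2 := H1 (p 2) (h.mem 2 (by omega)) x hxS
    omega
  by_cases hxb : G.Adj x (p (N - 1))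
  · obtain ⟨c1, c2⟩ := case2 (by omega) hc hnh H1 h hx hxS hxb.symm
    exact final (by omega) hc hnh H1 h hx hxS hxb.symm hxS h3 c1 c2
  · by_cases hs1 : nb G (p (N - 1)) ⊆ S
    · exact case1 hm hNm hc hnh H1 h hl hx hxS hxb hs1 H3
    · obtain ⟨y, hy, hyS⟩ := not_subset.1 hs1
      rw [mem_nb] at hy
      by_cases hy0 : G.Adj y (p 0)
      · obtain ⟨c1, c2⟩ := case2 (by omega) hc hnh H1 h hy0.symm hyS hy
        exact final (by omega) hc hnh H1 h hy0.symm hyS hy hyS h3 c1 c2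
      · have c2 := case3 (by omega) hc hnh H1 h hx hxS hxb hy hyS hy0
        have e1 : rv N p 0 = p (N - 1) := rfl
        have e2 : rv N p (N - 1) = p 0 := by simp [rv]
        have e3 : rv N p (N - 2) = p 1 := by clear H3; simp only [rv]; congr 1; omega
        have c1 := case3 (by omega) hc hnh H1 h.rev (x := y) (y := x) (by rw [e1]; exact hy) hyS
          (by rw [e2]; exact hy0) (by rw [e2]; exact hx) hxS (by rw [e1]; exact hxb)
        rw [e2, e3] at c1
        exact final (by omega) hc hnh H1 h hx hxS hy hyS h3 c1 c2

theorem GT {m : ℕ} (hm : 4 ≤ m) {G₀ : SimpleGraph V} (h₀ : Rlz d G₀) (hc : S.card = 2 * m - 1)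
    (H1 : ∀ s ∈ S, ∀ o, o ∉ S → d o ≤ d s)
    (H2 : ∀ k, 1 ≤ k → k ≤ m - 2 → (S.filter (fun s => d s ≤ k)).card < k)
    (H3 : (S.filter (fun s => d s ≤ m - 1)).card ≤ m - 1 ∨ (∃ w ∈ S, d w = m) ∨
      ∀ s ∈ S, d s ≤ m - 1) : ∃ G p, Rlz d G ∧ HamC G S (2 * m - 1) p := by
  by_contra hcon
  push Not at hcon
  obtain ⟨N, hNm⟩ : ∃ N, N = 2 * m - 1 := ⟨_, rfl⟩
  rw [← hNm] at hcon hc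
  have hnh : NoHam d S N := hcon
  obtain ⟨p₀, h1, h2⟩ := exists_ord hc (by omega)
  obtain ⟨G, p, hs, hmx⟩ := exists_st h₀ h1 h2
  have hMM : MM d S N G p := ⟨hs, hmx⟩
  have low : ∀ q, MM d S N G q → m - 1 ≤ d (q 0) := by
    intro q hq
    by_contra hlt
    have a := low_count hq hc (by omega) H1 (by omega)
    by_cases h0 : d (q 0) = 0
    · have b := H2 1 le_rfl (by omega)
      have : q 0 ∈ S.filter (fun s => d s ≤ 1) := by
        rw [mem_filter]; exact ⟨hq.st.mem 0 (by omega), by omega⟩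
      have := card_pos.2 ⟨_, this⟩
      omega
    · have b := H2 (d (q 0)) (by omega) (by omega)
      omega
  have hk := low p hMM
  have hl : m - 1 ≤ d (p (N - 1)) := low _ hMM.rev
  have e2 : rv N p (N - 1) = p 0 := by simp [rv]
  by_cases hs0 : nb G (p 0) ⊆ S
  · by_cases hs1 : nb G (p (N - 1)) ⊆ S
    · exact inside hm hNm hc hnh hMM hk hl hs0 hs1 H3
    · obtain ⟨y, hy, hyS⟩ := not_subset.1 hs1
      rw [mem_nb] at hy
      exact outside hm hNm hc hnh H1 hs.rev (by rw [e2]; exact hk) hy hyS H3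
  · obtain ⟨y, hy, hyS⟩ := not_subset.1 hs0
    rw [mem_nb] at hy
    exact outside hm hNm hc hnh H1 hs hl hy hyS H3

end

section

variable {d : V → ℕ} {S : Finset V} {N : ℕ} {G G' : SimpleGraph V} {p p' : ℕ → V}

/-- vertices of degree at least `t` -/
def lv (d : V → ℕ) (t : ℕ) : Finset V := univ.filter (fun v => t ≤ d v)

@[simp] lemma mem_lv {t : ℕ} {v : V} : v ∈ lv d t ↔ t ≤ d v := by simp [lv]

def Pos (m : ℕ) (d : V → ℕ) : Prop :=
  ∀ k, 1 ≤ k → k ≤ m - 1 → 2 * m + 1 - k ≤ (lv d (k + 1)).card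

def Concl (m : ℕ) (d : V → ℕ) : Prop :=
  ∃ G S, Rlz d G ∧ S.card = 2 * m ∧ Top d S ∧ ∀ r ∈ Icc 3 (2 * m), Cyc G S r

lemma top_count (hS : Top d S) {c t : ℕ} (h1 : c ≤ (lv d t).card) (h2 : c ≤ S.card) :
    c ≤ (S.filter (fun v => t ≤ d v)).card := by
  by_cases h : ∃ o, o ∉ S ∧ t ≤ d o
  · obtain ⟨o, ho, ht⟩ := h
    rw [filter_true_of_mem]
    · exact h2
    · intro s hs; exact ht.trans (hS s hs o ho)
  · push Not at h
    refine h1.trans (card_le_card ?_)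
    intro v hv
    rw [mem_lv] at hv
    rw [mem_filter]
    refine ⟨?_, hv⟩
    by_contra hvS
    have := h v hvS
    omega

lemma top_low {m : ℕ} (hP : Pos m d) (hS : Top d S) (hc : S.card = 2 * m) {k : ℕ} (hk : 1 ≤ k)
    (hk' : k ≤ m - 1) : (S.filter (fun s => d s ≤ k)).card < k := by
  have h1 := top_count hS (hP k hk hk') (by omega)
  have h2 := card_filter_add_card_filter_not (s := S) (fun s => d s ≤ k)
  have h3 : (S.filter (fun s => ¬ d s ≤ k)) = S.filter (fun v => k + 1 ≤ d v) := by
    apply filter_congr; intro v _; omega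
  rw [h3] at h2
  omega

lemma hubgen {m : ℕ} (hm : 4 ≤ m) {G₀ : SimpleGraph V} (h₀ : Rlz d G₀) (g : V) {S' : Finset V}
    (hg : g ∉ S') (hc : S'.card = 2 * m - 1)
    (H1 : ∀ s ∈ S', ∀ o, o ∉ S' → dl d g (nb G₀ g) o ≤ dl d g (nb G₀ g) s)
    (H2 : ∀ k, 1 ≤ k → k ≤ m - 2 → (S'.filter (fun s => dl d g (nb G₀ g) s ≤ k)).card < k)
    (H3 : (S'.filter (fun s => dl d g (nb G₀ g) s ≤ m - 1)).card ≤ m - 1 ∨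
      (∃ w ∈ S', dl d g (nb G₀ g) w = m) ∨ ∀ s ∈ S', dl d g (nb G₀ g) s ≤ m - 1)
    (hd : m ≤ (S' ∩ nb G₀ g).card) :
    ∃ G, Rlz d G ∧ ∀ r ∈ Icc 3 (2 * m), Cyc G (insert g S') r := by
  obtain ⟨G, p, hr, hp⟩ := GT hm (del_rlz h₀ g) hc H1 H2 H3
  have hgn : g ∉ nb G₀ g := by simp
  have hr' := add_rlz hr hgn (by
    intro v hv
    rw [mem_nb] at hv
    rw [← h₀ v]
    exact card_pos.2 ⟨g, by simpa using hv.symm⟩) (h₀ g).symm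
  refine ⟨_, hr', fun r hr => ?_⟩
  rw [mem_Icc] at hr
  refine hub (by omega) hc (p := p) ⟨hp.mem, hp.inj, fun i hi => addS_le _ _ (hp.adj i hi),
    addS_le _ _ hp.close⟩ hg ?_ r hr.1 hr.2
  refine hd.trans (card_le_card ?_)
  intro v hv
  rw [mem_inter] at hv
  rw [mem_filter]
  refine ⟨hv.1, ?_, Or.inr (Or.inl ⟨rfl, hv.2⟩)⟩
  rintro rfl; exact hg hv.1

lemma T2a {m : ℕ} (hm : 4 ≤ m) {G₀ : SimpleGraph V} (h₀ : Rlz d G₀) (hP : Pos m d) {g : V}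
    (hg : d g = m) (hF : (lv d m).card ≤ 2 * m) : Concl m d := by
  obtain ⟨G, hG, htop⟩ := HH h₀ g
  have cQ : (nb G g).card = m := (hG g).trans hg
  have cF : m + 2 ≤ (lv d m).card := by
    have := hP (m - 1) (by omega) le_rfl
    rw [show m - 1 + 1 = m by omega] at this
    omega
  have hgQ : g ∉ nb G g := by simp
  have hQ : ∀ u ∈ nb G g, m ≤ d u := by
    intro u hu
    by_contra hlt
    have hsub : lv d m ⊆ insert g ((nb G g).erase u) := by
      intro v hv
      rw [mem_lv] at hv
      rw [mem_insert, mem_erase, mem_nb]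
      by_cases hvg : v = g
      · exact Or.inl hvg
      · right
        refine ⟨by rintro rfl; exact hlt hv, ?_⟩
        by_contra hn
        have := htop u v (by simpa using hu) hn hvg
        omega
    have h1 := card_le_card hsub
    have h2 := card_insert_le g ((nb G g).erase u)
    have h3 := card_erase_of_mem hu
    omega
  obtain ⟨S, -, hSc, hS⟩ := exists_top d univ (2 * m) (by
    have h1 := hP 1 le_rfl (by omega)
    have h2 := card_le_card (subset_univ (lv d (1 + 1)))
    omega)
  have hT : Top d S := fun s hs o ho => hS s hs o (mem_univ o) ho
  have hFS : ∀ v, m ≤ d v → v ∈ S := by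
    intro v hv
    by_contra hvS
    have hsub : insert v S ⊆ lv d m := by
      intro u hu
      rw [mem_insert] at hu
      rw [mem_lv]
      rcases hu with rfl | hu
      · exact hv
      · exact hv.trans (hT u hu v hvS)
    have := card_le_card hsub
    rw [card_insert_of_notMem hvS] at this
    omega
  have hgS : g ∈ S := hFS g hg.ge
  have hc : (S.erase g).card = 2 * m - 1 := by rw [card_erase_of_mem hgS, hSc]
  have hins : insert g (S.erase g) = S := insert_erase hgS
  have hlow : ∀ k, k ≤ m - 2 → ∀ s ∈ S.erase g, dl d g (nb G g) s ≤ k → d s ≤ k := by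
    intro k hk s hs h
    rw [mem_erase] at hs
    simp only [dl, hs.1, if_false] at h
    split_ifs at h with h1
    · have := hQ s h1; omega
    · exact h
  have hgen := hubgen hm hG g (S' := S.erase g) (by simp) hc ?_ ?_ ?_ ?_
  · obtain ⟨G1, h1, h2⟩ := hgen
    rw [hins] at h2
    exact ⟨G1, S, h1, hSc, hT, h2⟩
  · intro s hs o ho
    rw [mem_erase] at hs
    by_cases hog : o = g
    · simp [dl, hog]
    have hoS : o ∉ S := fun h => ho (mem_erase.2 ⟨hog, h⟩)
    have hom : d o < m := by by_contra hcon; exact hoS (hFS o (by omega))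
    have hoQ : o ∉ nb G g := fun h => by have := hQ o h; omega
    have e1 : dl d g (nb G g) o = d o := by simp only [dl, hog, if_false, hoQ]
    rw [e1]
    simp only [dl, hs.1, if_false]
    split_ifs with h1
    · have := hQ s h1; omega
    · exact hT s hs.2 o hoS
  · intro k hk hk'
    refine lt_of_le_of_lt (card_le_card ?_) (top_low hP hT hSc hk (by omega))
    intro s hs
    rw [mem_filter] at hs ⊢
    exact ⟨mem_of_mem_erase hs.1, hlow k hk' s hs.1 hs.2⟩
  · by_cases hall : ∀ u ∈ nb G g, m + 1 ≤ d u
    · left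
      have := top_low hP hT hSc (k := m - 1) (by omega) le_rfl
      refine le_trans (card_le_card ?_) this.le
      intro s hs
      rw [mem_filter, mem_erase] at hs
      rw [mem_filter]
      refine ⟨hs.1.2, ?_⟩
      have h2 := hs.2
      simp only [dl, hs.1.1, if_false] at h2
      split_ifs at h2 with h1
      · have := hall s h1; omega
      · exact h2
    · push Not at hall
      obtain ⟨u, hu, hdu⟩ := hall
      obtain ⟨w, hw, hw'⟩ : ∃ w ∈ lv d m, w ∉ insert g (nb G g) := by
        apply exists_mem_notMem_of_card_lt_card
        rw [card_insert_of_notMem hgQ]; omega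
      rw [mem_lv] at hw
      rw [mem_insert, not_or, mem_nb] at hw'
      right; left
      refine ⟨w, mem_erase.2 ⟨hw'.1, hFS w hw⟩, ?_⟩
      have h1 := htop u w (by simpa using hu) hw'.2 hw'.1
      simp only [dl, hw'.1, if_false, mem_nb, hw'.2]
      omega
  · rw [inter_eq_right.2, cQ]
    intro u hu
    exact mem_erase.2 ⟨by rintro rfl; exact hgQ hu, hFS u (hQ u hu)⟩

lemma Rb {m : ℕ} (hm : 4 ≤ m) {G₀ : SimpleGraph V} (h₀ : Rlz d G₀) {g : V}
    (hg : m + 1 ≤ d g) (hoth : ∀ v, v ≠ g → 0 < d v → d v = m)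
    (hF : (lv d 1).card = 2 * m + 1) : Concl m d := by
  have cQ := h₀ g
  obtain ⟨x, hx⟩ : (nb G₀ g).Nonempty := card_pos.1 (by omega)
  have hxg : x ≠ g := by rintro rfl; simp at hx
  have hposQ : ∀ v ∈ nb G₀ g, 0 < d v := by
    intro v hv
    rw [mem_nb] at hv
    rw [← h₀ v]
    exact card_pos.2 ⟨g, by simpa using hv.symm⟩
  set S' := ((lv d 1).erase x).erase g with hS'
  have mS' : ∀ v, v ∈ S' ↔ v ≠ g ∧ v ≠ x ∧ 0 < d v := by
    intro v; simp only [hS', mem_erase, mem_lv]; rfl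
  have hc : S'.card = 2 * m - 1 := by
    rw [hS', card_erase_of_mem, card_erase_of_mem, hF]
    · omega
    · rw [mem_lv]; exact hposQ x hx
    · rw [mem_erase, mem_lv]; exact ⟨hxg.symm, by omega⟩
  have hgS : g ∉ S' := by rw [mS']; exact fun h => h.1 rfl
  have val : ∀ s ∈ S', m - 1 ≤ dl d g (nb G₀ g) s := by
    intro s hs
    rw [mS'] at hs
    have := hoth s hs.1 hs.2.2
    simp only [dl, hs.1, if_false]
    split_ifs <;> omega
  have hgen := hubgen hm h₀ g (S' := S') hgS hc ?_ ?_ ?_ ?_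
  · obtain ⟨G1, h1, h2⟩ := hgen
    refine ⟨G1, _, h1, by rw [card_insert_of_notMem hgS]; omega, ?_, h2⟩
    intro s hs o ho
    rw [mem_insert, not_or, mS'] at ho
    have hdo : d o ≤ m := by
      by_cases h0 : 0 < d o
      · exact (hoth o ho.1 h0).le
      · omega
    rw [mem_insert, mS'] at hs
    rcases hs with rfl | hs
    · omega
    · have := hoth s hs.1 hs.2.2; omega
  · intro s hs o ho
    refine le_trans ?_ (val s hs)
    by_cases hog : o = g
    · simp [dl, hog]
    by_cases hox : o = x
    · subst hox
      have := hoth o hxg (hposQ o hx)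
      simp only [dl, hxg, if_false, hx, if_true]
      omega
    have : d o = 0 := by
      by_contra hne
      exact ho ((mS' o).2 ⟨hog, hox, by omega⟩)
    simp only [dl, hog, if_false]
    split_ifs <;> omega
  · intro k hk hk'
    rw [filter_false_of_mem]
    · simp; omega
    · intro s hs; have := val s hs; omega
  · right
    by_cases hw : ∃ w ∈ S', w ∉ nb G₀ g
    · left
      obtain ⟨w, hw, hw'⟩ := hw
      refine ⟨w, hw, ?_⟩
      rw [mS'] at hw
      simp only [dl, hw.1, if_false, hw']
      exact hoth w hw.1 hw.2.2
    · right
      push Not at hw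
      intro s hs
      have h1 := hw s hs
      rw [mS'] at hs
      have := hoth s hs.1 hs.2.2
      simp only [dl, hs.1, if_false, h1, if_true]
      omega
  · have hsub : (nb G₀ g).erase x ⊆ S' ∩ nb G₀ g := by
      intro v hv
      rw [mem_erase] at hv
      rw [mem_inter, mS']
      exact ⟨⟨by rintro rfl; simp at hv, hv.1, hposQ v hv.2⟩, hv.2⟩
    have := card_le_card hsub
    rw [card_erase_of_mem hx] at this
    omega

lemma HamC.rot {k : ℕ} (hN : 3 ≤ N) (h : HamC G S N p) (hk : k < N) :
    HamC G S N (fun t => p ((t + k) % N)) := by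
  have hsucc : ∀ a < N, G.Adj (p a) (p ((a + 1) % N)) := by
    intro a ha
    by_cases h1 : a + 1 < N
    · rw [Nat.mod_eq_of_lt h1]; exact h.adj a h1
    · have : a = N - 1 := by omega
      subst this
      rw [show N - 1 + 1 = N by omega, Nat.mod_self]; exact h.close
  refine ⟨fun i _ => h.mem _ (Nat.mod_lt _ (by omega)), ?_, ?_, ?_⟩
  · intro i hi j hj he
    have := h.inj _ (Nat.mod_lt _ (by omega)) _ (Nat.mod_lt _ (by omega)) he
    rw [mod_cases N i k hi hk, mod_cases N j k hj hk] at this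
    split_ifs at this <;> omega
  · intro i hi
    have := hsucc ((i + k) % N) (Nat.mod_lt _ (by omega))
    rw [Nat.mod_add_mod, show i + k + 1 = i + 1 + k by omega] at this
    exact this
  · have := hsucc ((N - 1 + k) % N) (Nat.mod_lt _ (by omega))
    rw [Nat.mod_add_mod, show N - 1 + k + 1 = 0 + k + N by omega, Nat.add_mod_right] at this
    exact this

lemma T1base {m : ℕ} (hm : 4 ≤ m) {G₀ : SimpleGraph V} (h₀ : Rlz d G₀) (hP : Pos m d)
    (hq : m + 2 ≤ (lv d (m + 1)).card) (hn : (lv d 1).card = 2 * m) : Concl m d := by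
  have hout : ∀ o, o ∉ lv d 1 → d o = 0 := by
    intro o ho; rw [mem_lv] at ho; omega
  have hT : Top d (lv d 1) := by
    intro s _ o ho; rw [hout o ho]; omega
  obtain ⟨G, p, hr, hp⟩ := posa h₀ hn (by omega) hout (fun k hk hk' =>
    top_low hP hT hn hk (by omega))
  have hin : ∀ v, nb G v ⊆ lv d 1 := by
    intro v u hu
    rw [mem_nb] at hu
    rw [mem_lv, ← hr u]
    exact card_pos.2 ⟨v, by simpa using hu.symm⟩
  set A := (range (2 * m)).filter (fun i => m + 1 ≤ d (p i)) with hA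
  have cA : m + 2 ≤ A.card := by
    have hsub : lv d (m + 1) ⊆ A.image p := by
      intro v hv
      rw [mem_lv] at hv
      obtain ⟨i, hi, rfl⟩ := ord_surj hn hp.mem hp.inj v (by rw [mem_lv]; omega)
      exact mem_image_of_mem p (by rw [hA, mem_filter, mem_range]; exact ⟨hi, hv⟩)
    exact hq.trans ((card_le_card hsub).trans card_image_le)
  obtain ⟨i, hi, hdi, hdi'⟩ : ∃ i, i + 1 < 2 * m ∧ m + 1 ≤ d (p i) ∧ m + 1 ≤ d (p (i + 1)) := by
    obtain ⟨i, hi, j, hj, hij, he⟩ := exists_ne_map_eq_of_card_lt_of_maps_to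
      (s := A) (t := range m) (f := fun i => i / 2) (by rw [card_range]; omega) (by
        intro i hi
        rw [mem_coe, hA, mem_filter, mem_range] at hi
        simp only [coe_range, Set.mem_Iio]; omega)
    rw [hA, mem_filter, mem_range] at hi hj
    rcases Nat.lt_or_gt_of_ne hij with h | h
    · have : j = i + 1 := by omega
      subst this; exact ⟨i, by omega, hi.2, hj.2⟩
    · have : i = j + 1 := by omega
      subst this; exact ⟨j, by omega, hj.2, hi.2⟩
  have hp' := hp.rot (by omega) hi
  refine ⟨G, lv d 1, hr, hn, hT, fun r hr' => ?_⟩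
  rw [mem_Icc] at hr'
  refine bondy (by omega) hn hp' (hin _) (hin _) ?_ r hr'.1 hr'.2
  rw [hr, hr]
  rw [show (0 + (i + 1)) % (2 * m) = i + 1 by rw [Nat.zero_add]; exact Nat.mod_eq_of_lt hi,
    show (2 * m - 1 + (i + 1)) % (2 * m) = i by
      rw [mod_cases _ _ _ (by omega) hi, if_neg (by omega)]; omega]
  omega

lemma layoff {m : ℕ} (hm : 4 ≤ m) {z : V} (hz : 0 < d z) (hzmin : ∀ v, 0 < d v → d z ≤ d v)
    (hn : 2 * m + 1 ≤ (lv d 1).card) (hG : Rlz d G) (hC : Concl m (dl d z (nb G z))) :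
    Concl m d := by
  have hposQ : ∀ v ∈ nb G z, 0 < d v := by
    intro v hv
    rw [mem_nb] at hv
    rw [← hG v]
    exact card_pos.2 ⟨z, by simpa using hv.symm⟩
  have hzQ : z ∉ nb G z := by simp
  obtain ⟨G1, S1, hr1, hc1, hT1, hcy⟩ := hC
  set e : V → ℕ := fun v => dl d z (nb G z) v + d v with he
  have hz1 : z ∈ lv d 1 := by rw [mem_lv]; exact hz
  obtain ⟨S, hSU, hSc, hS⟩ := exists_top e (univ.erase z) (2 * m) (by
    have := card_le_card (erase_subset_erase z (subset_univ (lv d 1)))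
    rw [card_erase_of_mem hz1] at this
    omega)
  have hzS : z ∉ S := fun h => by simpa using hSU h
  have key : ∀ s ∈ S, ∀ o, o ∉ S → o ≠ z → dl d z (nb G z) o ≤ dl d z (nb G z) s ∧ d o ≤ d s := by
    intro s hs o ho hoz
    have h1 := hS s hs o (by simp [hoz]) ho
    have hsz : s ≠ z := by rintro rfl; exact hzS hs
    have p1 := hposQ s
    have p2 := hposQ o
    simp only [he, dl, hsz, hoz, if_false] at h1 ⊢
    split_ifs at h1 ⊢ with a b b <;> simp_all <;> omega
  have hTd : Top (dl d z (nb G z)) S := by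
    intro s hs o ho
    by_cases hoz : o = z
    · simp [dl, hoz]
    · exact (key s hs o ho hoz).1
  have hpos : ∀ s ∈ S, 0 < d s := by
    intro s hs
    by_contra h0
    have hsub : lv d 1 ⊆ insert z (S.erase s) := by
      intro v hv
      rw [mem_lv] at hv
      rw [mem_insert, mem_erase]
      by_cases hvz : v = z
      · exact Or.inl hvz
      · right
        refine ⟨by rintro rfl; omega, ?_⟩
        by_contra hvS
        have := (key s hs v hvS hvz).2
        omega
    have h1 := card_le_card hsub
    have h2 := card_insert_le z (S.erase s)
    have h3 := card_erase_of_mem hs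
    omega
  have hT : Top d S := by
    intro s hs o ho
    by_cases hoz : o = z
    · rw [hoz]; exact hzmin s (hpos s hs)
    · exact (key s hs o ho hoz).2
  obtain ⟨G2, hr2, hcy2⟩ := transfer _ (Icc 3 (2 * m)) S hTd _ S1 G1 rfl (by rw [hc1, hSc]) hT1 hr1 hcy
  exact ⟨_, S, add_rlz hr2 hzQ hposQ (hG z).symm, hSc, hT,
    fun r hr => (hcy2 r hr).mono (fun u v h => addS_le _ _ h)⟩

end

section

variable {d : V → ℕ} {S : Finset V} {N : ℕ} {G G' : SimpleGraph V} {p p' : ℕ → V}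

/-- circulant graph along the order `p` with connection set `D` -/
def circ (n : ℕ) (D : Finset ℕ) (p : ℕ → V) (hp : ∀ i < n, ∀ j < n, p i = p j → i = j)
    (hD : ∀ x ∈ D, 0 < x ∧ x < n ∧ n - x ∈ D) : SimpleGraph V where
  Adj u v := ∃ i < n, ∃ x ∈ D, u = p i ∧ v = p ((i + x) % n)
  symm := ⟨by
    rintro u v ⟨i, hi, x, hx, rfl, rfl⟩
    obtain ⟨h1, h2, h3⟩ := hD x hx
    refine ⟨(i + x) % n, Nat.mod_lt _ (by omega), n - x, h3, rfl, ?_⟩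
    rw [Nat.mod_add_mod, show i + x + (n - x) = i + n by omega, Nat.add_mod_right,
      Nat.mod_eq_of_lt hi]⟩
  loopless := ⟨by
    rintro u ⟨i, hi, x, hx, rfl, he⟩
    obtain ⟨h1, h2, h3⟩ := hD x hx
    have := hp _ hi _ (Nat.mod_lt _ (by omega)) he
    rw [mod_cases n i x hi h2] at this
    split_ifs at this <;> omega⟩

lemma circ_card {n : ℕ} {D : Finset ℕ} {p : ℕ → V} (hp : ∀ i < n, ∀ j < n, p i = p j → i = j)
    (hD : ∀ x ∈ D, 0 < x ∧ x < n ∧ n - x ∈ D) {i : ℕ} (hi : i < n) :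
    (nb (circ n D p hp hD) (p i)).card = D.card := by
  have : nb (circ n D p hp hD) (p i) = D.image (fun x => p ((i + x) % n)) := by
    ext v
    simp only [mem_nb, mem_image, circ]
    constructor
    · rintro ⟨j, hj, x, hx, he, rfl⟩
      have := hp _ hi _ hj he
      subst this
      exact ⟨x, hx, rfl⟩
    · rintro ⟨x, hx, rfl⟩
      exact ⟨i, hi, x, hx, rfl, rfl⟩
  rw [this, card_image_of_injOn]
  intro x hx y hy he
  obtain ⟨-, h2, -⟩ := hD x hx
  obtain ⟨-, h2', -⟩ := hD y hy
  have := hp _ (Nat.mod_lt _ (by omega)) _ (Nat.mod_lt _ (by omega)) he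
  rw [mod_cases n i x hi h2, mod_cases n i y hi h2'] at this
  split_ifs at this <;> omega

lemma exists_D {m n : ℕ} (hm : 4 ≤ m) (hn : 2 * m ≤ n) (hpar : Even m ∨ Even n) :
    ∃ D : Finset ℕ, D.card = m ∧ 1 ∈ D ∧ 2 ∈ D ∧ ∀ x ∈ D, 0 < x ∧ x < n ∧ n - x ∈ D := by
  have hdis : Disjoint (Icc 1 (m / 2)) (Icc (n - m / 2) (n - 1)) := by
    rw [disjoint_left]; intro x; simp only [mem_Icc]; omega
  have hcard : (Icc 1 (m / 2) ∪ Icc (n - m / 2) (n - 1)).card = 2 * (m / 2) := by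
    rw [card_union_of_disjoint hdis, Nat.card_Icc, Nat.card_Icc]; omega
  by_cases he : Even m
  · refine ⟨Icc 1 (m / 2) ∪ Icc (n - m / 2) (n - 1), ?_, ?_, ?_, ?_⟩
    · rw [hcard]; obtain ⟨a, rfl⟩ := he; omega
    · simp only [mem_union, mem_Icc]; omega
    · simp only [mem_union, mem_Icc]; omega
    · intro x; simp only [mem_union, mem_Icc]; omega
  · have hn2 : Even n := hpar.resolve_left he
    obtain ⟨a, rfl⟩ := hn2
    rw [Nat.not_even_iff_odd] at he
    obtain ⟨b, rfl⟩ := he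
    refine ⟨insert a (Icc 1 ((2 * b + 1) / 2) ∪ Icc (a + a - (2 * b + 1) / 2) (a + a - 1)), ?_, ?_, ?_, ?_⟩
    · rw [card_insert_of_notMem, hcard]
      · omega
      · simp only [mem_union, mem_Icc]; omega
    · simp only [mem_insert, mem_union, mem_Icc]; omega
    · simp only [mem_insert, mem_union, mem_Icc]; omega
    · intro x; simp only [mem_insert, mem_union, mem_Icc]; omega

lemma regular {m : ℕ} (hm : 4 ≤ m) (hreg : ∀ v, 0 < d v → d v = m)
    (hn : 2 * m ≤ (lv d 1).card) (hpar : Even m ∨ Even (lv d 1).card) : Concl m d := by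
  obtain ⟨n, hn'⟩ : ∃ n, n = (lv d 1).card := ⟨_, rfl⟩
  rw [← hn'] at hn hpar
  obtain ⟨p, hpm, hp⟩ := exists_ord (S := lv d 1) (N := n) hn'.symm (by omega)
  obtain ⟨D, cD, h1, h2, hD⟩ := exists_D hm hn hpar
  have hdp : ∀ i < n, d (p i) = m := fun i hi => hreg _ (by have := hpm i hi; rwa [mem_lv] at this)
  have step : ∀ i j, i < j → j < n → j ≤ i + 2 → (circ n D p hp hD).Adj (p i) (p j) := by
    intro i j hij hj hj2
    refine ⟨i, by omega, j - i, ?_, rfl, ?_⟩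
    · rcases (show j - i = 1 ∨ j - i = 2 by omega) with h | h <;> rw [h] <;> assumption
    · rw [show i + (j - i) = j by omega, Nat.mod_eq_of_lt hj]
  refine ⟨circ n D p hp hD, (range (2 * m)).image p, ?_, ?_, ?_, ?_⟩
  · intro v
    by_cases hv : 0 < d v
    · obtain ⟨i, hi, rfl⟩ := ord_surj hn'.symm hpm hp v (by rw [mem_lv]; exact hv)
      rw [circ_card hp hD hi, cD, hdp i hi]
    · rw [show d v = 0 by omega, card_eq_zero, eq_empty_iff_forall_notMem]
      intro u hu
      rw [mem_nb] at hu
      obtain ⟨i, hi, x, hx, rfl, -⟩ := hu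
      have := hdp i hi
      omega
  · rw [card_image_of_injOn, card_range]
    intro i hi j hj he
    simp only [coe_range, Set.mem_Iio] at hi hj
    exact hp i (by omega) j (by omega) he
  · intro s hs o _
    rw [mem_image] at hs
    obtain ⟨i, hi, rfl⟩ := hs
    rw [mem_range] at hi
    rw [hdp i (by omega)]
    by_cases ho : 0 < d o
    · exact (hreg o ho).le
    · omega
  · intro r hr
    rw [mem_Icc] at hr
    refine ⟨fun i => p (if 2 * i < r then 2 * i else 2 * r - 2 * i - 1), ?_, ?_, ?_, ?_⟩
    · intro i hi
      apply mem_image_of_mem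
      rw [mem_range]
      split_ifs <;> omega
    · intro i hi
      dsimp only
      by_cases a : 2 * i < r <;> by_cases b : 2 * (i + 1) < r
      · rw [if_pos a, if_pos b]; exact step _ _ (by omega) (by omega) (by omega)
      · rw [if_pos a, if_neg b]
        by_cases c : 2 * i < 2 * r - 2 * (i + 1) - 1
        · exact step _ _ c (by omega) (by omega)
        · exact (step _ _ (by omega) (by omega) (by omega)).symm
      · omega
      · rw [if_neg a, if_neg b]; exact (step _ _ (by omega) (by omega) (by omega)).symm
    · dsimp only
      rw [if_neg (by omega), if_pos (by omega)]
      exact (step _ _ (by omega) (by omega) (by omega)).symm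
    · intro i hi j hj he
      dsimp only at he
      have := hp _ (by split_ifs <;> omega) _ (by split_ifs <;> omega) he
      split_ifs at this <;> omega

lemma hand (h : Rlz d G) : Even (∑ v, d v) := by
  have h1 := G.sum_degrees_eq_twice_card_edges
  have h2 : ∑ v, d v = ∑ v, G.degree v := by
    apply sum_congr rfl
    intro v _
    rw [← h v, ← SimpleGraph.card_neighborFinset_eq_degree]
    congr 1
    ext u; simp
  rw [h2, h1]
  exact even_two_mul _

lemma lay_card (hG : Rlz d G) {z : V} (hz : 0 < d z) :
    (lv (dl d z (nb G z)) 1).card < (lv d 1).card := by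
  apply card_lt_card
  rw [ssubset_iff_of_subset]
  · exact ⟨z, by rw [mem_lv]; exact hz, by rw [mem_lv]; simp [dl]⟩
  · intro v hv
    rw [mem_lv] at *
    simp only [dl] at hv
    split_ifs at hv <;> omega

lemma pos_T1 {m : ℕ} (hm : 4 ≤ m) (hP : Pos m d) (hG : Rlz d G) {z : V} (hz : 0 < d z)
    (hzmin : ∀ v, 0 < d v → d z ≤ d v) (hn : 2 * m + 1 ≤ (lv d 1).card)
    (htop : ∀ u v, G.Adj z u → ¬ G.Adj z v → v ≠ z → d v ≤ d u)
    (hq : m + 2 ≤ (lv d (m + 1)).card) : Pos m (dl d z (nb G z)) := by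
  intro k hk hk'
  have hz1 : z ∈ lv d 1 := by rw [mem_lv]; exact hz
  have supp : (∀ v, v ≠ z → 0 < d v → k + 1 ≤ dl d z (nb G z) v) →
      2 * m + 1 - k ≤ (lv (dl d z (nb G z)) (k + 1)).card := by
    intro hall
    have hsub : (lv d 1).erase z ⊆ lv (dl d z (nb G z)) (k + 1) := by
      intro v hv
      rw [mem_erase, mem_lv] at hv
      rw [mem_lv]
      exact hall v hv.1 hv.2
    have := card_le_card hsub
    rw [card_erase_of_mem hz1] at this
    omega
  by_cases hc : m + 1 ≤ d z
  · apply supp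
    intro v hvz hv
    have := hzmin v hv
    simp only [dl, hvz, if_false]
    split_ifs <;> omega
  · have hQ : ∀ u ∈ nb G z, m + 1 ≤ d u := by
      intro u hu
      by_contra hlt
      have hsub : lv d (m + 1) ⊆ (nb G z).erase u := by
        intro v hv
        rw [mem_lv] at hv
        rw [mem_erase, mem_nb]
        refine ⟨by rintro rfl; exact hlt hv, ?_⟩
        by_contra hn
        have := htop u v (by simpa using hu) hn (by rintro rfl; exact hc hv)
        omega
      have h1 := card_le_card hsub
      rw [card_erase_of_mem hu, hG z] at h1
      omega
    have hd : ∀ v, v ≠ z → k + 1 ≤ d v → k + 1 ≤ dl d z (nb G z) v := by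
      intro v hvz hv
      simp only [dl, hvz, if_false]
      split_ifs with h
      · have := hQ v h; omega
      · exact hv
    by_cases hck : k + 1 ≤ d z
    · apply supp
      intro v hvz hv
      have := hzmin v hv
      exact hd v hvz (by omega)
    · refine (hP k hk hk').trans (card_le_card ?_)
      intro v hv
      rw [mem_lv] at *
      exact hd v (by rintro rfl; exact hck hv) hv

lemma pos_T2 {m : ℕ} (hm : 4 ≤ m) (hG : Rlz d G) {z : V}
    (hF : 2 * m + 1 ≤ (lv d m).card) (hz : d z ≤ m - 1) : Pos m (dl d z (nb G z)) := by
  intro k hk hk'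
  by_cases hkm : k = m - 1
  · subst hkm
    have hsub : lv d m \ nb G z ⊆ lv (dl d z (nb G z)) (m - 1 + 1) := by
      intro v hv
      rw [mem_sdiff, mem_lv] at hv
      have : v ≠ z := by rintro rfl; omega
      rw [mem_lv]
      simp only [dl, this, if_false, hv.2]
      omega
    have h1 := card_le_card hsub
    have h2 := le_card_sdiff (nb G z) (lv d m)
    have h3 := hG z
    omega
  · have hsub : lv d m ⊆ lv (dl d z (nb G z)) (k + 1) := by
      intro v hv
      rw [mem_lv] at hv
      have : v ≠ z := by rintro rfl; omega
      rw [mem_lv]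
      simp only [dl, this, if_false]
      split_ifs <;> omega
    have h1 := card_le_card hsub
    omega

lemma pos_T3 {m : ℕ} (hm : 4 ≤ m) (hG : Rlz d G) {z : V}
    (hzmin : ∀ v, 0 < d v → d z ≤ d v) (hn : 2 * m + 1 ≤ (lv d 1).card)
    (htop : ∀ u v, G.Adj z u → ¬ G.Adj z v → v ≠ z → d v ≤ d u) (hz : d z = m)
    (hq : 2 * m + 3 ≤ (lv d 1).card + (lv d (m + 1)).card) : Pos m (dl d z (nb G z)) := by
  intro k hk hk'
  have hz1 : z ∈ lv d 1 := by rw [mem_lv]; omega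
  have supp : (∀ v, v ≠ z → 0 < d v → k + 1 ≤ dl d z (nb G z) v) →
      2 * m + 1 - k ≤ (lv (dl d z (nb G z)) (k + 1)).card := by
    intro hall
    have hsub : (lv d 1).erase z ⊆ lv (dl d z (nb G z)) (k + 1) := by
      intro v hv
      rw [mem_erase, mem_lv] at hv
      rw [mem_lv]
      exact hall v hv.1 hv.2
    have := card_le_card hsub
    rw [card_erase_of_mem hz1] at this
    omega
  by_cases hkm : k = m - 1
  · by_cases hex : ∃ v, v ∉ nb G z ∧ v ≠ z ∧ m + 1 ≤ d v
    · obtain ⟨w, hw1, hw2, hw3⟩ := hex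
      rw [mem_nb] at hw1
      apply supp
      intro v hvz hv
      have h1 := hzmin v hv
      simp only [dl, hvz, if_false]
      split_ifs with h
      · have := htop v w (by simpa using h) hw1 hw2
        omega
      · omega
    · push Not at hex
      subst hkm
      have hAQ : lv d (m + 1) ⊆ nb G z := by
        intro v hv
        rw [mem_lv] at hv
        by_contra hvQ
        have := hex v hvQ (by rintro rfl; omega)
        omega
      have hsub : (lv d 1).erase z \ (nb G z \ lv d (m + 1)) ⊆ lv (dl d z (nb G z)) (m - 1 + 1) := by
        intro v hv
        rw [mem_sdiff, mem_erase, mem_lv, mem_sdiff, mem_lv] at hv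
        obtain ⟨⟨h1, h2⟩, h3⟩ := hv
        have := hzmin v h2
        rw [mem_lv]
        simp only [dl, h1, if_false]
        split_ifs with h
        · by_contra hlt
          exact h3 ⟨h, by omega⟩
        · omega
      have a1 := card_le_card hsub
      have a2 := le_card_sdiff (nb G z \ lv d (m + 1)) ((lv d 1).erase z)
      have a3 := card_sdiff_of_subset hAQ
      rw [hG z] at a3
      rw [card_erase_of_mem hz1] at a2
      have a4 := card_le_card hAQ
      rw [hG z] at a4
      omega
  · apply supp
    intro v hvz hv
    have h1 := hzmin v hv
    simp only [dl, hvz, if_false]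
    split_ifs <;> omega

theorem main {m : ℕ} (hm : 4 ≤ m) : ∀ (n : ℕ) (d : V → ℕ), (lv d 1).card = n →
    (∃ G, Rlz d G) → Pos m d → Concl m d := by
  intro n
  induction n using Nat.strong_induction_on with
  | _ n ih =>
  intro d hn hgr hP
  obtain ⟨G₀, h₀⟩ := hgr
  have mono : ∀ a b, a ≤ b → (lv d b).card ≤ (lv d a).card := by
    intro a b hab
    apply card_le_card
    intro v hv
    rw [mem_lv] at *
    omega
  have hn2 : 2 * m ≤ (lv d 1).card := by
    have h1 := hP 1 le_rfl (by omega)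
    have h2 := mono 1 (1 + 1) (by omega)
    omega
  obtain ⟨z, hz, hzmin⟩ := exists_min_image (lv d 1) d (card_pos.1 (by omega))
  rw [mem_lv] at hz
  have hzmin' : ∀ v, 0 < d v → d z ≤ d v := fun v hv => hzmin v (by rw [mem_lv]; exact hv)
  obtain ⟨G, hG, htop⟩ := HH h₀ z
  have lay : 2 * m + 1 ≤ (lv d 1).card → Pos m (dl d z (nb G z)) → Concl m d := by
    intro h1 h2
    exact layoff hm hz hzmin' h1 hG (ih _ (by rw [← hn]; exact lay_card hG hz) _ rfl
      ⟨_, del_rlz hG z⟩ h2)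
  by_cases hq : m + 2 ≤ (lv d (m + 1)).card
  · by_cases hnn : (lv d 1).card = 2 * m
    · exact T1base hm h₀ hP hq hnn
    · have h1 : 2 * m + 1 ≤ (lv d 1).card := by omega
      exact lay h1 (pos_T1 hm hP hG hz hzmin' h1 htop hq)
  have cF : m + 2 ≤ (lv d m).card := by
    have := hP (m - 1) (by omega) le_rfl
    rw [show m - 1 + 1 = m by omega] at this
    omega
  obtain ⟨g, hg, hg'⟩ := exists_mem_notMem_of_card_lt_card (s := lv d (m + 1)) (t := lv d m) (by omega)
  rw [mem_lv] at hg hg'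
  have hgm : d g = m := by omega
  by_cases hF : (lv d m).card ≤ 2 * m
  · exact T2a hm h₀ hP hgm hF
  have h1 : 2 * m + 1 ≤ (lv d 1).card := by have := mono 1 m (by omega); omega
  have hzg := hzmin' g (by omega)
  by_cases hzm : d z ≤ m - 1
  · exact lay h1 (pos_T2 hm hG (by omega) hzm)
  have hzm' : d z = m := by omega
  by_cases hq3 : 2 * m + 3 ≤ (lv d 1).card + (lv d (m + 1)).card
  · exact lay h1 (pos_T3 hm hG hzmin' h1 htop hzm' hq3)
  by_cases hq0 : (lv d (m + 1)).card = 0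
  · rw [card_eq_zero, eq_empty_iff_forall_notMem] at hq0
    have hreg : ∀ v, 0 < d v → d v = m := by
      intro v hv
      have a := hzmin' v hv
      have b := hq0 v
      rw [mem_lv] at b
      omega
    apply regular hm hreg hn2
    rcases (show (lv d 1).card = 2 * m + 1 ∨ (lv d 1).card = 2 * m + 2 by omega) with h | h
    · left
      have hs := hand h₀
      have : ∑ v, d v = (2 * m + 1) * m := by
        rw [← h, ← smul_eq_mul, ← sum_const]
        rw [← sum_subset (subset_univ (lv d 1))]
        · apply sum_congr rfl
          intro v hv
          rw [mem_lv] at hv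
          exact hreg v hv
        · intro v _ hv
          rw [mem_lv] at hv
          omega
      rw [this, Nat.even_mul] at hs
      rcases hs with hs | hs
      · obtain ⟨a, ha⟩ := hs; omega
      · exact hs
    · right; rw [h]; exact ⟨m + 1, by omega⟩
  · obtain ⟨g, hg⟩ := card_eq_one.1 (show (lv d (m + 1)).card = 1 by omega)
    have hgm : m + 1 ≤ d g := by rw [← mem_lv, hg]; exact mem_singleton_self g
    refine Rb hm h₀ hgm ?_ (by omega)
    intro v hvg hv
    have a := hzmin' v hv
    have b : v ∉ lv d (m + 1) := by rw [hg, mem_singleton]; exact hvg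
    rw [mem_lv] at b
    omega

end

end L28
end

/-- **Lemma 2.8.** If `m ≥ 4`, `n ≥ 2m` and `π = (d₁,…,dₙ)` is a non-increasing graphic
sequence with `d_{2m+1-i} ≥ i+1` for `1 ≤ i ≤ m-1`, then `π` has a realization containing
`C₃, …, C_{2m}` on those vertices with degrees `d₁, …, d_{2m}`. -/
theorem lemma28 (m n : ℕ) (hm : 4 ≤ m) (hn : 2 * m ≤ n) (d : Fin n → ℕ)
    (hanti : Antitone d) (hgr : Graphic d)
    (hposa : ∀ i : ℕ, ∀ _ : 1 ≤ i, ∀ _ : i ≤ m - 1, i + 1 ≤ d ⟨2 * m - i, by omega⟩) :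
    RealizationWithCyclesOn (2 * m) d := by
  classical
  have conv : ∀ G : SimpleGraph (Fin n), IsDegreeSeq G d ↔ L28.Rlz d G := by
    intro G
    refine forall_congr' fun v => ?_
    have : G.neighborSet v = (L28.nb G v : Set (Fin n)) := by
      ext u; simp
    rw [this, Set.ncard_coe_finset]
  obtain ⟨G₀, h₀⟩ := hgr
  have hP : L28.Pos m d := by
    intro k hk hk'
    have hsub : (Finset.univ.filter (fun i : Fin n => (i : ℕ) < 2 * m + 1 - k)) ⊆ L28.lv d (k + 1) := by
      intro i hi
      rw [Finset.mem_filter] at hi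
      rw [L28.mem_lv]
      refine (hposa k hk hk').trans (hanti ?_)
      rw [Fin.le_def]
      show (i : ℕ) ≤ 2 * m - k
      omega
    have hc := Finset.card_le_card hsub
    rw [Fin.card_filter_val_lt, min_eq_right (by omega)] at hc
    exact hc
  obtain ⟨G, S, hG, hc, hT, hcy⟩ := L28.main hm _ d rfl ⟨G₀, (conv G₀).1 h₀⟩ hP
  have cT : (Finset.univ.filter (fun i : Fin n => (i : ℕ) < 2 * m)).card = 2 * m := by
    rw [Fin.card_filter_val_lt, min_eq_right hn]
  obtain ⟨G', hG', hcy'⟩ := L28.transfer d (Finset.Icc 3 (2 * m))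
    (Finset.univ.filter (fun i : Fin n => (i : ℕ) < 2 * m)) (by
      intro s hs o ho
      simp only [Finset.mem_filter, Finset.mem_univ, true_and] at hs ho
      apply hanti
      rw [Fin.le_def]
      omega) _ S G rfl (by rw [hc, cT]) hT hG hcy
  refine ⟨G', _, (conv G').2 hG', cT, rfl, fun r h3 hr => ?_⟩
  obtain ⟨f, f1, f2, f3, f4⟩ := hcy' r (Finset.mem_Icc.2 ⟨h3, hr⟩)
  exact L28.CF G' _ f r h3 f1 f2 f3 f4
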